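/- Let (Ω, F, P) be a probability space with filtration {F_t}_{t≥0}, and let {X_t}_{2≤t≤T} be square-integrable real random variables such that X_t is F_t-measurable and E[X_t | F_{t−2}] = 0 almost surely for every t ≥ 2. Let S_T² = Var(Σ_{t=2}^T X_t). Assume: (a) the family {X_t² / E[X_t²] : 2 ≤ t ≤ T, T ∈ ℕ} is uniformly integrable; (b) T · max_{2≤t≤T} Var(X_t) / S_T² = O(1) as T → ∞; (c) there are positive integers b_T with b_T → ∞ and T/b_T → ∞, and, setting t_j = (j−1)b_T + 1 for 1 ≤ j ≤ J = ⌈T/b_T⌉ and t_{J+1} = T + 1, the blockwise predictable variance V_J² = Σ_{j=1}^J E[(Σ_{t=t_j+1}^{t_{j+1}−1} X_t)² | F_{t_j−1}] satisfies V_J² / E[V_J²] → 1 in probability as T → ∞. Then S_T^{-1} Σ_{t=2}^T X_t converges in distribution to the standard normal law N(0,1). -/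

import Mathlib

open MeasureTheory ProbabilityTheory Filter

namespace SRSB

variable {Ω : Type*} {m0 : MeasurableSpace Ω} {μ : Measure Ω}

/-- Martingale difference sequences in L². -/
structure IsMDS (G : Filtration ℕ m0) (D : ℕ → Ω → ℝ) (μ : Measure Ω) : Prop where
  meas : ∀ k, StronglyMeasurable[G (k + 1)] (D k)
  l2 : ∀ k, MemLp (D k) 2 μ
  cond : ∀ k, μ[D k | G k] =ᵐ[μ] 0

lemma integral_add3 {f g h : Ω → ℝ} (hf : Integrable f μ) (hg : Integrable g μ)
    (hh : Integrable h μ) :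
    ∫ ω, (f ω + g ω + h ω) ∂μ = ∫ ω, f ω ∂μ + ∫ ω, g ω ∂μ + ∫ ω, h ω ∂μ := by
  rw [← integral_add hf hg]
  exact integral_add (hf.add hg) hh

lemma integral_add4 {f g h k : Ω → ℝ} (hf : Integrable f μ) (hg : Integrable g μ)
    (hh : Integrable h μ) (hk : Integrable k μ) :
    ∫ ω, (f ω + g ω + h ω + k ω) ∂μ =
      ∫ ω, f ω ∂μ + ∫ ω, g ω ∂μ + ∫ ω, h ω ∂μ + ∫ ω, k ω ∂μ := by
  rw [← integral_add3 hf hg hh]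
  exact integral_add ((hf.add hg).add hh) hk

lemma int_mul_zero [IsProbabilityMeasure μ] {m : MeasurableSpace Ω} (hm : m ≤ m0) {U Y : Ω → ℝ}
    (hU : StronglyMeasurable[m] U) (hUY : Integrable (fun ω => U ω * Y ω) μ)
    (hY : Integrable Y μ) (h : μ[Y | m] =ᵐ[μ] 0) : ∫ ω, U ω * Y ω ∂μ = 0 := by
  rw [← integral_condExp hm]
  have h1 := condExp_mul_of_stronglyMeasurable_left (μ := μ) hU hUY hY
  have h2 : μ[fun ω => U ω * Y ω | m] =ᵐ[μ] fun _ => 0 := by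
    refine h1.trans ?_
    filter_upwards [h] with ω hω
    simp [hω]
  rw [integral_congr_ae h2]
  simp

lemma IsMDS.sum_meas {G : Filtration ℕ m0} {D : ℕ → Ω → ℝ} (h : IsMDS G D μ) (n : ℕ) :
    StronglyMeasurable[G n] (fun ω => ∑ k ∈ Finset.range n, D k ω) := by
  apply Finset.stronglyMeasurable_fun_sum
  intro k hk
  exact (h.meas k).mono (G.mono (by simpa using hk))

lemma IsMDS.sum_l2 {G : Filtration ℕ m0} {D : ℕ → Ω → ℝ} (h : IsMDS G D μ) (n : ℕ) :
    MemLp (fun ω => ∑ k ∈ Finset.range n, D k ω) 2 μ :=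
  memLp_finsetSum _ fun k _ => h.l2 k

lemma IsMDS.sq_sum [IsProbabilityMeasure μ] {G : Filtration ℕ m0} {D : ℕ → Ω → ℝ}
    (h : IsMDS G D μ) (n : ℕ) :
    ∫ ω, (∑ k ∈ Finset.range n, D k ω) ^ 2 ∂μ = ∑ k ∈ Finset.range n, ∫ ω, (D k ω) ^ 2 ∂μ := by
  induction n with
  | zero => simp
  | succ n ih =>
    rw [Finset.sum_range_succ, ← ih]
    have hi : Integrable (fun ω => (∑ k ∈ Finset.range n, D k ω) * D n ω) μ :=
      (h.sum_l2 n).integrable_mul (h.l2 n)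
    have h0 := int_mul_zero (G.le n) (h.sum_meas n) hi ((h.l2 n).integrable (by norm_num)) (h.cond n)
    have e : ∀ ω, (∑ k ∈ Finset.range (n + 1), D k ω) ^ 2 =
        (∑ k ∈ Finset.range n, D k ω) ^ 2 + 2 * ((∑ k ∈ Finset.range n, D k ω) * D n ω)
          + (D n ω) ^ 2 := by
      intro ω; rw [Finset.sum_range_succ]; ring
    simp_rw [e]
    rw [integral_add3 (h.sum_l2 n).integrable_sq (hi.const_mul 2) (h.l2 n).integrable_sq,
      integral_const_mul, h0]
    ring

lemma integrable_of_bdd [IsProbabilityMeasure μ] {f : Ω → ℝ} (hf : AEStronglyMeasurable f μ)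
    (c : ℝ) (h : ∀ᵐ ω ∂μ, |f ω| ≤ c) : Integrable f μ :=
  Integrable.of_bound hf c (by simpa using h)

lemma IsMDS.fourth [IsProbabilityMeasure μ] {G : Filtration ℕ m0} {D : ℕ → Ω → ℝ}
    (h : IsMDS G D μ) {c : ℝ} (hc : 0 ≤ c) (n : ℕ)
    (hb : ∀ k < n, ∀ᵐ ω ∂μ, |D k ω| ≤ c) :
    ∫ ω, (∑ k ∈ Finset.range n, D k ω) ^ 4 ∂μ ≤ 4 * (n : ℝ) ^ 2 * c ^ 4 := by
  induction n with
  | zero => simp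
  | succ n ih =>
    replace ih := ih fun k hk => hb k (by omega)
    have hbn := hb n (by omega)
    have hbr : ∀ k ∈ Finset.range n, ∀ᵐ ω ∂μ, |D k ω| ≤ c :=
      fun k hk => hb k (by have := Finset.mem_range.1 hk; omega)
    set S : Ω → ℝ := fun ω => ∑ k ∈ Finset.range n, D k ω with hS
    have hSm : StronglyMeasurable[G n] S := h.sum_meas n
    have hSm' : AEStronglyMeasurable S μ := (hSm.mono (G.le n)).aestronglyMeasurable
    have hDm' : AEStronglyMeasurable (D n) μ := ((h.meas n).mono (G.le _)).aestronglyMeasurable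
    have hSb : ∀ᵐ ω ∂μ, |S ω| ≤ n * c := by
      filter_upwards [(Filter.eventually_all_finset _).2 hbr] with ω hω
      calc |S ω| ≤ ∑ k ∈ Finset.range n, |D k ω| := Finset.abs_sum_le_sum_abs _ _
        _ ≤ ∑ k ∈ Finset.range n, c := Finset.sum_le_sum fun k hk => hω k hk
        _ = n * c := by simp
    have hpqi : ∀ p q : ℕ, Integrable (fun ω => S ω ^ p * D n ω ^ q) μ := by
      intro p q
      refine integrable_of_bdd ((hSm'.pow p).mul (hDm'.pow q)) ((n * c) ^ p * c ^ q) ?_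
      filter_upwards [hSb, hbn] with ω h1 h2
      rw [abs_mul, abs_pow, abs_pow]
      gcongr
    have h3 : ∫ ω, S ω ^ 3 * D n ω ∂μ = 0 :=
      int_mul_zero (G.le n) (hSm.pow 3) (by simpa using hpqi 3 1)
        ((h.l2 n).integrable (by norm_num)) (h.cond n)
    have hS2 : ∫ ω, S ω ^ 2 ∂μ ≤ n * c ^ 2 := by
      rw [hS, h.sq_sum n]
      calc _ ≤ ∑ k ∈ Finset.range n, c ^ 2 := by
            apply Finset.sum_le_sum
            intro k hk
            calc _ ≤ ∫ ω, c ^ 2 ∂μ := by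
                  apply integral_mono_ae (h.l2 k).integrable_sq (integrable_const _)
                  filter_upwards [hbr k hk] with ω hω
                  exact sq_le_sq' (by linarith [neg_abs_le (D k ω)]) ((le_abs_self _).trans hω)
              _ = c ^ 2 := by simp
        _ = n * c ^ 2 := by simp
    have hle : ∫ ω, (∑ k ∈ Finset.range (n + 1), D k ω) ^ 4 ∂μ ≤
        ∫ ω, (S ω ^ 4 + 4 * (S ω ^ 3 * D n ω) + 8 * c ^ 2 * S ω ^ 2 + 3 * c ^ 4) ∂μ := by
      have i4 : Integrable (fun ω => S ω ^ 4) μ := by simpa using hpqi 4 0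
      have i2 : Integrable (fun ω => S ω ^ 2) μ := by simpa using hpqi 2 0
      have i3 : Integrable (fun ω => S ω ^ 3 * D n ω) μ := by simpa using hpqi 3 1
      apply integral_mono_of_nonneg
      · exact ae_of_all _ fun ω => by positivity
      · exact ((i4.add (i3.const_mul 4)).add (i2.const_mul _)).add (integrable_const _)
      · filter_upwards [hbn] with ω hω
        rw [Finset.sum_range_succ]
        have hd2 : D n ω ^ 2 ≤ c ^ 2 :=
          sq_le_sq' (by linarith [neg_abs_le (D n ω)]) ((le_abs_self _).trans hω)
        have hd4 : (D n ω ^ 2) ^ 2 ≤ (c ^ 2) ^ 2 := by gcongr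
        change (S ω + D n ω) ^ 4 ≤ _
        have e : (S ω + D n ω) ^ 4 = S ω ^ 4 + 4 * (S ω ^ 3 * D n ω) + 8 * (D n ω ^ 2) * S ω ^ 2
          + 3 * (D n ω ^ 2) ^ 2 - 2 * (D n ω * (S ω - D n ω)) ^ 2 := by ring
        have : D n ω ^ 2 * S ω ^ 2 ≤ c ^ 2 * S ω ^ 2 := by gcongr
        nlinarith [sq_nonneg (D n ω * (S ω - D n ω))]
    have i4 : Integrable (fun ω => S ω ^ 4) μ := by simpa using hpqi 4 0
    have i2 : Integrable (fun ω => S ω ^ 2) μ := by simpa using hpqi 2 0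
    have i3 : Integrable (fun ω => S ω ^ 3 * D n ω) μ := by simpa using hpqi 3 1
    rw [integral_add4 i4 (i3.const_mul 4) (i2.const_mul _) (integrable_const _),
      integral_const_mul, integral_const_mul, h3] at hle
    simp only [integral_const, probReal_univ, smul_eq_mul, one_mul] at hle
    push_cast
    have : c ^ 2 * ∫ ω, S ω ^ 2 ∂μ ≤ c ^ 2 * (n * c ^ 2) := by gcongr
    have hc4 : 0 ≤ c ^ 4 := by positivity
    nlinarith

/-- tail square -/
noncomputable def tsq (L x : ℝ) : ℝ := if L < x ^ 2 then x ^ 2 else 0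

lemma tsq_nonneg (L x : ℝ) : 0 ≤ tsq L x := by unfold tsq; split_ifs <;> positivity
lemma tsq_le_sq (L x : ℝ) : tsq L x ≤ x ^ 2 := by
  unfold tsq; split_ifs <;> [exact le_rfl; positivity]
lemma tsq_le_fourth {L : ℝ} (hL : 0 < L) (x : ℝ) : tsq L x ≤ x ^ 4 / L := by
  unfold tsq; split_ifs with h
  · rw [le_div_iff₀ hL]; nlinarith [sq_nonneg x]
  · positivity
lemma tsq_add (L x y : ℝ) : tsq L (x + y) ≤ 4 * tsq (L / 4) x + 4 * tsq (L / 4) y := by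
  have hx := tsq_nonneg (L / 4) x
  have hy := tsq_nonneg (L / 4) y
  by_cases h : L < (x + y) ^ 2
  · have e : tsq L (x + y) = (x + y) ^ 2 := by simp [tsq, h]
    rcases le_total (y ^ 2) (x ^ 2) with hh | hh
    · have h1 : (x + y) ^ 2 ≤ 4 * x ^ 2 := by nlinarith [sq_nonneg (x - y)]
      have e2 : tsq (L / 4) x = x ^ 2 := by
        unfold tsq; rw [if_pos]; linarith
      linarith
    · have h1 : (x + y) ^ 2 ≤ 4 * y ^ 2 := by nlinarith [sq_nonneg (x - y)]
      have e2 : tsq (L / 4) y = y ^ 2 := by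
        unfold tsq; rw [if_pos]; linarith
      linarith
  · have e : tsq L (x + y) = 0 := by simp [tsq, h]
    linarith

lemma measurable_tsq (L : ℝ) : Measurable (tsq L) := by
  unfold tsq
  exact Measurable.ite (measurableSet_lt measurable_const (by fun_prop)) (by fun_prop)
    measurable_const

lemma integrable_tsq {f : Ω → ℝ} (hf : MemLp f 2 μ) (L : ℝ) :
    Integrable (fun ω => tsq L (f ω)) μ := by
  refine hf.integrable_sq.mono'
    ((measurable_tsq L).comp_aemeasurable hf.aestronglyMeasurable.aemeasurable).aestronglyMeasurable
    (ae_of_all _ fun ω => ?_)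
  rw [Real.norm_of_nonneg (tsq_nonneg _ _)]
  exact tsq_le_sq _ _

lemma int_tsq_add {f g : Ω → ℝ} (hf : MemLp f 2 μ) (hg : MemLp g 2 μ) (L : ℝ) :
    ∫ ω, tsq L (f ω + g ω) ∂μ ≤
      4 * ∫ ω, tsq (L / 4) (f ω) ∂μ + 4 * ∫ ω, tsq (L / 4) (g ω) ∂μ := by
  rw [← integral_const_mul, ← integral_const_mul, ← integral_add]
  · apply integral_mono (integrable_tsq (hf.add hg) L)
    · exact ((integrable_tsq hf _).const_mul 4).add ((integrable_tsq hg _).const_mul 4)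
    · exact fun ω => tsq_add _ _ _
  · exact (integrable_tsq hf _).const_mul 4
  · exact (integrable_tsq hg _).const_mul 4


lemma int_sub_condExp_sq_le [IsProbabilityMeasure μ] {m : MeasurableSpace Ω} (hm : m ≤ m0)
    {R : Ω → ℝ} (hR : MemLp R 2 μ) :
    ∫ ω, (R ω - (μ[R | m]) ω) ^ 2 ∂μ ≤ ∫ ω, R ω ^ 2 ∂μ := by
  have h := condVar_ae_le_condExp_sq (μ := μ) hm hR
  have h2 := integral_mono_ae integrable_condVar integrable_condExp h
  rw [condVar, integral_condExp hm, integral_condExp hm] at h2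
  simpa using h2

lemma IsMDS.lind [IsProbabilityMeasure μ] {G : Filtration ℕ m0} {D : ℕ → Ω → ℝ}
    (h : IsMDS G D μ) {M K η L : ℝ} (hM : 0 ≤ M) (hK : 0 ≤ K) (hL : 0 < L) (n : ℕ)
    (hv : ∀ k < n, ∫ ω, (D k ω) ^ 2 ∂μ ≤ M)
    (hU : ∀ k < n, ∫ ω, tsq (K * ∫ ω, (D k ω) ^ 2 ∂μ) (D k ω) ∂μ ≤ η * M) :
    ∫ ω, tsq L (∑ k ∈ Finset.range n, D k ω) ∂μ ≤
      4 * ((4 * (n : ℝ) ^ 2 * (16 * (K * M) ^ 2)) / (L / 4)) + 4 * (n * (η * M)) := by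
  set v : ℕ → ℝ := fun k => ∫ ω, (D k ω) ^ 2 ∂μ with hvdef
  have hDm : ∀ k, Measurable[G (k + 1)] (D k) := fun k => (h.meas k).measurable
  set A : ℕ → Ω → ℝ := fun k ω => if (D k ω) ^ 2 ≤ K * v k then D k ω else 0 with hA
  have hAm : ∀ k, StronglyMeasurable[G (k + 1)] (A k) := by
    intro k
    apply Measurable.stronglyMeasurable
    exact Measurable.ite (measurableSet_le ((hDm k).pow_const 2) measurable_const) (hDm k)
      measurable_const
  have hAle : ∀ k ω, |A k ω| ≤ |D k ω| := by
    intro k ω; simp only [hA]; split_ifs <;> simp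
  have hAb : ∀ k ω, |A k ω| ≤ √(K * v k) := by
    intro k ω; simp only [hA]; split_ifs with h1
    · exact Real.abs_le_sqrt h1
    · simp
  have hA2 : ∀ k, MemLp (A k) 2 μ := fun k =>
    (h.l2 k).mono ((hAm k).mono (G.le _)).aestronglyMeasurable (ae_of_all _ fun ω => hAle k ω)
  have hCm : ∀ k, StronglyMeasurable[G (k + 1)] (μ[A k | G k]) := fun k =>
    stronglyMeasurable_condExp.mono (G.mono (Nat.le_succ k))
  have hC2 : ∀ k, MemLp (μ[A k | G k]) 2 μ := fun k => (hA2 k).condExp (by norm_num)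
  set Y : ℕ → Ω → ℝ := fun k => A k - μ[A k | G k] with hY
  set Z : ℕ → Ω → ℝ := fun k => D k - Y k with hZ
  have hYi : ∀ k, μ[Y k | G k] =ᵐ[μ] 0 := by
    intro k
    have h1 := condExp_sub (μ := μ) ((hA2 k).integrable (by norm_num))
      ((hC2 k).integrable (by norm_num)) (G k)
    have h2 : μ[μ[A k | G k] | G k] = μ[A k | G k] :=
      condExp_of_stronglyMeasurable (G.le k) stronglyMeasurable_condExp integrable_condExp
    rw [h2] at h1
    simpa using h1
  have hYM : IsMDS G Y μ := ⟨fun k => (hAm k).sub (hCm k), fun k => (hA2 k).sub (hC2 k), hYi⟩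
  have hZM : IsMDS G Z μ := by
    refine ⟨fun k => (h.meas k).sub (hYM.meas k), fun k => (h.l2 k).sub (hYM.l2 k), fun k => ?_⟩
    have h1 := condExp_sub (μ := μ) ((h.l2 k).integrable (by norm_num))
      ((hYM.l2 k).integrable (by norm_num)) (G k)
    refine h1.trans ?_
    filter_upwards [h.cond k, hYi k] with ω e1 e2
    simp [e1, e2]
  have hYb : ∀ k < n, ∀ᵐ ω ∂μ, |Y k ω| ≤ 2 * √(K * M) := by
    intro k hk
    have h0 : √(K * v k) ≤ √(K * M) := Real.sqrt_le_sqrt (mul_le_mul_of_nonneg_left (hv k hk) hK)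
    have h1 : ∀ᵐ ω ∂μ, |(μ[A k | G k]) ω| ≤ √(K * M) :=
      ae_bdd_abs_condExp_of_ae_bdd_abs (ae_of_all _ fun ω => (hAb k ω).trans h0)
    filter_upwards [h1] with ω h2
    calc |A k ω - (μ[A k | G k]) ω| ≤ |A k ω| + |(μ[A k | G k]) ω| := abs_sub _ _
      _ ≤ _ := by linarith [hAb k ω]
  have hY4 := hYM.fourth (by positivity) n hYb
  have hc4 : (2 * √(K * M)) ^ 4 = 16 * (K * M) ^ 2 := by
    have : √(K * M) ^ 2 = K * M := Real.sq_sqrt (by positivity)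
    calc (2 * √(K * M)) ^ 4 = 16 * (√(K * M) ^ 2) ^ 2 := by ring
      _ = _ := by rw [this]
  rw [hc4] at hY4
  have hZ2 : ∀ k < n, ∫ ω, Z k ω ^ 2 ∂μ ≤ η * M := by
    intro k hk
    have hR2 : MemLp (D k - A k) 2 μ := (h.l2 k).sub (hA2 k)
    have h1 := int_sub_condExp_sq_le (G.le k) hR2
    have h2 := condExp_sub (μ := μ) ((h.l2 k).integrable (by norm_num))
      ((hA2 k).integrable (by norm_num)) (G k)
    calc ∫ ω, Z k ω ^ 2 ∂μ = ∫ ω, ((D k - A k) ω - (μ[D k - A k | G k]) ω) ^ 2 ∂μ := by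
          apply integral_congr_ae
          filter_upwards [h2, h.cond k] with ω e1 e2
          simp only [e1, Pi.sub_apply, e2, hZ, hY, Pi.zero_apply]
          ring
      _ ≤ _ := h1
      _ = ∫ ω, tsq (K * v k) (D k ω) ∂μ := by
          apply integral_congr_ae
          refine ae_of_all _ fun ω => ?_
          simp only [Pi.sub_apply, hA, tsq]
          by_cases hc : D k ω ^ 2 ≤ K * v k
          · simp [hc, not_lt.2 hc]
          · simp [hc, not_le.1 hc]
      _ ≤ _ := hU k hk
  have hsum : ∀ ω, ∑ k ∈ Finset.range n, D k ω =
      ∑ k ∈ Finset.range n, Y k ω + ∑ k ∈ Finset.range n, Z k ω := by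
    intro ω
    rw [← Finset.sum_add_distrib]
    exact Finset.sum_congr rfl fun k _ => by simp [hZ]
  simp_rw [hsum]
  refine (int_tsq_add (hYM.sum_l2 n) (hZM.sum_l2 n) L).trans ?_
  have hYbs : ∀ᵐ ω ∂μ, |∑ k ∈ Finset.range n, Y k ω| ≤ n * (2 * √(K * M)) := by
    filter_upwards [(Filter.eventually_all_finset (Finset.range n)).2
      fun k hk => hYb k (Finset.mem_range.1 hk)] with ω hω
    calc _ ≤ ∑ k ∈ Finset.range n, |Y k ω| := Finset.abs_sum_le_sum_abs _ _
      _ ≤ ∑ k ∈ Finset.range n, 2 * √(K * M) := Finset.sum_le_sum fun k hk => hω k hk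
      _ = _ := by simp
  have hY4i : Integrable (fun ω => (∑ k ∈ Finset.range n, Y k ω) ^ 4) μ := by
    refine integrable_of_bdd ((hYM.sum_l2 n).aestronglyMeasurable.pow 4)
      ((n * (2 * √(K * M))) ^ 4) ?_
    filter_upwards [hYbs] with ω hω
    rw [abs_pow]; gcongr
  have hP : ∫ ω, tsq (L / 4) (∑ k ∈ Finset.range n, Y k ω) ∂μ ≤
      (4 * (n : ℝ) ^ 2 * (16 * (K * M) ^ 2)) / (L / 4) := by
    calc _ ≤ ∫ ω, (∑ k ∈ Finset.range n, Y k ω) ^ 4 / (L / 4) ∂μ :=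
          integral_mono (integrable_tsq (hYM.sum_l2 n) _) (hY4i.div_const _)
            fun ω => tsq_le_fourth (by positivity) _
      _ = (∫ ω, (∑ k ∈ Finset.range n, Y k ω) ^ 4 ∂μ) / (L / 4) := integral_div _ _
      _ ≤ _ := by gcongr
  have hQ : ∫ ω, tsq (L / 4) (∑ k ∈ Finset.range n, Z k ω) ∂μ ≤ n * (η * M) := by
    calc _ ≤ ∫ ω, (∑ k ∈ Finset.range n, Z k ω) ^ 2 ∂μ :=
          integral_mono (integrable_tsq (hZM.sum_l2 n) _) (hZM.sum_l2 n).integrable_sq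
            fun ω => tsq_le_sq _ _
      _ = _ := hZM.sq_sum n
      _ ≤ ∑ k ∈ Finset.range n, η * M :=
          Finset.sum_le_sum fun k hk => hZ2 k (Finset.mem_range.1 hk)
      _ = _ := by simp
  linarith

lemma sum_parity (a : ℕ → ℝ) (n : ℕ) :
    ∑ i ∈ Finset.range n, a i = ∑ k ∈ Finset.range ((n + 1) / 2), a (2 * k) +
      ∑ k ∈ Finset.range (n / 2), a (2 * k + 1) := by
  induction n with
  | zero => simp
  | succ n ih =>
    rw [Finset.sum_range_succ, ih]
    rcases Nat.even_or_odd' n with ⟨m, rfl | rfl⟩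
    · have e1 : (2 * m + 1) / 2 = m := by omega
      have e2 : 2 * m / 2 = m := by omega
      have e3 : (2 * m + 1 + 1) / 2 = m + 1 := by omega
      rw [e1, e2, e3, Finset.sum_range_succ]; ring
    · have e1 : (2 * m + 1) / 2 = m := by omega
      have e4 : (2 * m + 1 + 1 + 1) / 2 = m + 1 := by omega
      have e3 : (2 * m + 1 + 1) / 2 = m + 1 := by omega
      rw [e1, e3, e4, Finset.sum_range_succ (n := m) (f := fun k => a (2 * k + 1))]; ring

/-- subsampled filtration -/
def subF (ℱ : Filtration ℕ m0) (g : ℕ → ℕ) (hg : Monotone g) : Filtration ℕ m0 where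
  seq k := ℱ (g k)
  mono' := fun _ _ hij => ℱ.mono (hg hij)
  le' k := ℱ.le _

lemma block_lind [IsProbabilityMeasure μ] (ℱ : Filtration ℕ m0) (X : ℕ → Ω → ℝ)
    (hmeas : ∀ t, 2 ≤ t → StronglyMeasurable[ℱ t] (X t))
    (hL2 : ∀ t, 2 ≤ t → MemLp (X t) 2 μ)
    (hlag2 : ∀ t, 2 ≤ t → μ[X t | ℱ (t - 2)] =ᵐ[μ] 0)
    {M K η L : ℝ} (hM : 0 ≤ M) (hK : 0 ≤ K) (hη : 0 ≤ η) (hL : 0 < L) (p n : ℕ) (hp : 2 ≤ p)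
    (hv : ∀ i < n, ∫ ω, (X (p + i) ω) ^ 2 ∂μ ≤ M)
    (hU : ∀ t, 2 ≤ t →
      ∫ ω, tsq (K * ∫ ω, (X t ω) ^ 2 ∂μ) (X t ω) ∂μ ≤ η * ∫ ω, (X t ω) ^ 2 ∂μ) :
    ∫ ω, tsq L (∑ i ∈ Finset.range n, X (p + i) ω) ∂μ ≤
      32768 * ((n : ℝ) ^ 2 * (K * M) ^ 2 / L) + 32 * (n * (η * M)) := by
  have hmds : ∀ r, IsMDS (subF ℱ (fun k => p + r + 2 * k - 2) (fun i j hij => by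
      simp only; omega)) (fun k => X (p + r + 2 * k)) μ := by
    intro r
    refine ⟨fun k => ?_, fun k => hL2 _ (by omega), fun k => hlag2 _ (by omega)⟩
    have := hmeas (p + r + 2 * k) (by omega)
    change StronglyMeasurable[ℱ (p + r + 2 * (k + 1) - 2)] _
    have e : p + r + 2 * (k + 1) - 2 = p + r + 2 * k := by omega
    rw [e]; exact this
  have key : ∀ r q, (∀ k < q, r + 2 * k < n) → q ≤ n →
      ∫ ω, tsq (L / 4) (∑ k ∈ Finset.range q, X (p + r + 2 * k) ω) ∂μ ≤
        4 * ((4 * (n : ℝ) ^ 2 * (16 * (K * M) ^ 2)) / (L / 4 / 4)) + 4 * (n * (η * M)) := by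
    intro r q hq hqn
    have hvv : ∀ k < q, ∫ ω, (X (p + r + 2 * k) ω) ^ 2 ∂μ ≤ M := by
      intro k hk
      have := hv (r + 2 * k) (hq k hk)
      rwa [← add_assoc] at this
    refine ((hmds r).lind (L := L / 4) hM hK (by positivity) q hvv
      (fun k hk => (hU _ (by omega)).trans
        (mul_le_mul_of_nonneg_left (hvv k hk) hη))).trans ?_
    have : (q : ℝ) ≤ n := by exact_mod_cast hqn
    gcongr
  have e : ∀ ω, ∑ i ∈ Finset.range n, X (p + i) ω =
      ∑ k ∈ Finset.range ((n + 1) / 2), X (p + 0 + 2 * k) ω +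
        ∑ k ∈ Finset.range (n / 2), X (p + 1 + 2 * k) ω := by
    intro ω
    rw [sum_parity]
    congr 1
    exact Finset.sum_congr rfl fun k _ => by rw [show p + (2 * k + 1) = p + 1 + 2 * k by omega]
  simp_rw [e]
  refine (int_tsq_add ((hmds 0).sum_l2 _) ((hmds 1).sum_l2 _) L).trans ?_
  have k0 := key 0 ((n + 1) / 2) (fun k hk => by omega) (by omega)
  have k1 := key 1 (n / 2) (fun k hk => by omega) (by omega)
  have e2 : 4 * ((4 * (n : ℝ) ^ 2 * (16 * (K * M) ^ 2)) / (L / 4 / 4)) =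
      4096 * ((n : ℝ) ^ 2 * (K * M) ^ 2 / L) := by
    field_simp; ring
  rw [e2] at k0 k1
  linarith


lemma taylor2 (x : ℝ) :
    ‖Complex.exp (Complex.I * x) - 1 - Complex.I * x + (x : ℂ) ^ 2 / 2‖ ≤ 4 * |x| ^ 3 ∧
    ‖Complex.exp (Complex.I * x) - 1 - Complex.I * x + (x : ℂ) ^ 2 / 2‖ ≤ 4 * x ^ 2 := by
  have hx2 : x ^ 2 = |x| ^ 2 := (sq_abs x).symm
  have h0 := abs_nonneg x
  rcases le_total |x| 1 with hx | hx
  · have hn : ‖Complex.I * (x : ℂ)‖ = |x| := by simp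
    have hb := Complex.exp_bound (x := Complex.I * x) (by rw [hn]; exact hx) (n := 3) (by norm_num)
    rw [hn] at hb
    have e : Complex.exp (Complex.I * x) - ∑ m ∈ Finset.range 3, (Complex.I * x) ^ m / (m.factorial : ℂ)
        = Complex.exp (Complex.I * x) - 1 - Complex.I * x + (x : ℂ) ^ 2 / 2 := by
      simp only [Finset.sum_range_succ, Finset.sum_range_zero, Nat.factorial]
      push_cast
      rw [mul_pow _ _ 2, Complex.I_sq]
      ring
    rw [e] at hb
    have h3 : |x| ^ 3 ≤ |x| ^ 2 := pow_le_pow_of_le_one h0 hx (by norm_num)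
    have h3' : 0 ≤ |x| ^ 3 := by positivity
    have hb' : ‖Complex.exp (Complex.I * x) - 1 - Complex.I * x + (x : ℂ) ^ 2 / 2‖ ≤ |x| ^ 3 := by
      refine hb.trans ?_
      norm_num [Nat.factorial]
      linarith
    rw [hx2]
    constructor <;> linarith
  · have hb : ‖Complex.exp (Complex.I * x) - 1 - Complex.I * x + (x : ℂ) ^ 2 / 2‖ ≤
        1 + 1 + |x| + |x| ^ 2 / 2 := by
      refine (norm_add_le _ _).trans ?_
      have h1 := norm_sub_le (Complex.exp (Complex.I * x) - 1) (Complex.I * x)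
      have h2 := norm_sub_le (Complex.exp (Complex.I * x)) 1
      have h3 : ‖Complex.exp (Complex.I * x)‖ = 1 := by
        rw [mul_comm]; exact Complex.norm_exp_ofReal_mul_I x
      have h4 : ‖Complex.I * (x : ℂ)‖ = |x| := by simp
      have h5 : ‖(x : ℂ) ^ 2 / 2‖ = |x| ^ 2 / 2 := by simp
      rw [h3] at h2
      rw [h4] at h1
      rw [h5]
      simp at h2
      linarith
    have h3 : |x| ^ 2 ≤ |x| ^ 3 := pow_le_pow_right₀ hx (by norm_num)
    rw [hx2]
    constructor <;> nlinarith

lemma taylor_tsq (t d ε : ℝ) (hε : 0 ≤ ε) :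
    ‖Complex.exp (Complex.I * ((t * d : ℝ) : ℂ)) - 1 - Complex.I * ((t * d : ℝ) : ℂ)
      + ((t * d : ℝ) : ℂ) ^ 2 / 2‖ ≤ 4 * |t| ^ 3 * ε * d ^ 2 + 4 * t ^ 2 * tsq (ε ^ 2) d := by
  obtain ⟨h1, h2⟩ := taylor2 (t * d)
  have ht := tsq_nonneg (ε ^ 2) d
  by_cases h : ε ^ 2 < d ^ 2
  · have e : tsq (ε ^ 2) d = d ^ 2 := by simp [tsq, h]
    rw [e]
    have : 0 ≤ 4 * |t| ^ 3 * ε * d ^ 2 := by positivity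
    nlinarith
  · have hd : |d| ≤ ε := abs_le_of_sq_le_sq (not_lt.1 h) hε
    have e : |t * d| ^ 3 = |t| ^ 3 * (|d| * d ^ 2) := by
      rw [abs_mul, ← sq_abs d]; ring
    have h3 : |t| ^ 3 * (|d| * d ^ 2) ≤ |t| ^ 3 * (ε * d ^ 2) := by gcongr
    have : 0 ≤ 4 * t ^ 2 * tsq (ε ^ 2) d := by positivity
    rw [e] at h1
    linarith

lemma exp_neg_taylor {y : ℝ} (hy : 0 ≤ y) : |Real.exp (-y) - 1 + y| ≤ y ^ 2 := by
  rcases le_total y 1 with h | h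
  · have := Real.abs_exp_sub_one_sub_id_le (x := -y) (by rw [abs_neg, abs_of_nonneg hy]; exact h)
    simpa using this
  · have h1 : Real.exp (-y) ≤ 1 := Real.exp_le_one_iff.2 (by linarith)
    have h2 := Real.add_one_le_exp (-y)
    rw [abs_le]; constructor <;> nlinarith

lemma integral_zero_of_re_im {f : Ω → ℂ} (hf : Integrable f μ) (h1 : ∫ ω, (f ω).re ∂μ = 0)
    (h2 : ∫ ω, (f ω).im ∂μ = 0) : ∫ ω, f ω ∂μ = 0 := by
  rw [← integral_re_add_im hf]
  simp [h1, h2]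

lemma int_mul_zeroC [IsProbabilityMeasure μ] {m : MeasurableSpace Ω} (hm : m ≤ m0) {U : Ω → ℂ}
    {Y : Ω → ℝ} (hU : StronglyMeasurable[m] U) (hU1 : ∀ ω, ‖U ω‖ ≤ 1)
    (hY : Integrable Y μ) (h : μ[Y | m] =ᵐ[μ] 0) :
    Integrable (fun ω => U ω * (Y ω : ℂ)) μ ∧ ∫ ω, U ω * (Y ω : ℂ) ∂μ = 0 := by
  have hUm : AEStronglyMeasurable[m0] U μ := (hU.mono hm).aestronglyMeasurable
  have hi : Integrable (fun ω => U ω * (Y ω : ℂ)) μ :=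
    hY.ofReal.bdd_mul (c := 1) hUm (ae_of_all _ hU1)
  refine ⟨hi, ?_⟩
  have hre : StronglyMeasurable[m] fun ω => (U ω).re :=
    Complex.continuous_re.comp_stronglyMeasurable hU
  have him : StronglyMeasurable[m] fun ω => (U ω).im :=
    Complex.continuous_im.comp_stronglyMeasurable hU
  have ire : Integrable (fun ω => (U ω).re * Y ω) μ := by
    simpa using hi.re
  have iim : Integrable (fun ω => (U ω).im * Y ω) μ := by
    simpa using hi.im
  have z1 := int_mul_zero hm hre ire hY h
  have z2 := int_mul_zero hm him iim hY h
  exact integral_zero_of_re_im hi (by simpa using z1) (by simpa using z2)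

lemma step [IsProbabilityMeasure μ] {m : MeasurableSpace Ω} (hm : m ≤ m0) {U : Ω → ℂ}
    (hU : StronglyMeasurable[m] U) (hU1 : ∀ ω, ‖U ω‖ ≤ 1) {d σ δ : Ω → ℝ}
    (hd : MemLp d 2 μ) (hd0 : μ[d | m] =ᵐ[μ] 0) (hσ : μ[fun ω => d ω ^ 2 | m] =ᵐ[μ] σ)
    (hσm : StronglyMeasurable[m] σ)
    (hδm : StronglyMeasurable[m] δ) (hδ : ∀ᵐ ω ∂μ, 0 ≤ δ ω ∧ δ ω ≤ σ ω ∧ δ ω ≤ 1)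
    (t ε : ℝ) (hε : 0 ≤ ε) :
    ‖∫ ω, U ω * (Complex.exp (Complex.I * ((t * d ω : ℝ) : ℂ))
        - ((Real.exp (-(t ^ 2 / 2 * δ ω)) : ℝ) : ℂ)) ∂μ‖ ≤
      (4 * |t| ^ 3 * ε * ∫ ω, d ω ^ 2 ∂μ + 4 * t ^ 2 * ∫ ω, tsq (ε ^ 2) (d ω) ∂μ)
      + t ^ 2 / 2 * ∫ ω, (σ ω - δ ω) ∂μ
      + t ^ 4 / 4 * (ε ^ 2 * ∫ ω, δ ω ∂μ + ∫ ω, tsq (ε ^ 2) (d ω) ∂μ) := by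
  have hσi : Integrable σ μ := integrable_condExp.congr hσ
  have hdi : Integrable d μ := hd.integrable (by norm_num)
  have hd2 : Integrable (fun ω => d ω ^ 2) μ := hd.integrable_sq
  have hδm' : AEStronglyMeasurable[m0] δ μ := (hδm.mono hm).aestronglyMeasurable
  have hδi : Integrable δ μ := integrable_of_bdd hδm' 1 (by
    filter_upwards [hδ] with ω h; rw [abs_of_nonneg h.1]; exact h.2.2)
  have hδ2i : Integrable (fun ω => δ ω ^ 2) μ := integrable_of_bdd (hδm'.pow 2) 1 (by
    filter_upwards [hδ] with ω h; rw [abs_of_nonneg (sq_nonneg _)]; nlinarith [h.1, h.2.2])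
  have hti : Integrable (fun ω => tsq (ε ^ 2) (d ω)) μ := integrable_tsq hd _
  have hY : Integrable (fun ω => d ω ^ 2 - σ ω) μ := hd2.sub hσi
  have hY0 : μ[fun ω => d ω ^ 2 - σ ω | m] =ᵐ[μ] 0 := by
    have h1 := condExp_sub (μ := μ) hd2 hσi m
    refine h1.trans ?_
    rw [condExp_of_stronglyMeasurable hm hσm hσi]
    filter_upwards [hσ] with ω e
    simp [e]
  -- δ² bound
  have hδb : ∀ᵐ ω ∂μ, ‖δ ω‖ ≤ 1 := by
    filter_upwards [hδ] with ω h; rw [Real.norm_of_nonneg h.1]; exact h.2.2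
  have iδYn : Integrable (fun ω => -(δ ω * (d ω ^ 2 - σ ω))) μ :=
    (hY.bdd_mul (c := 1) hδm' hδb).neg
  have iδY : Integrable (fun ω => δ ω * (d ω ^ 2 - σ ω)) μ := hY.bdd_mul (c := 1) hδm' hδb
  have zδ := int_mul_zero hm hδm iδY hY hY0
  have hδ2 : ∫ ω, δ ω ^ 2 ∂μ ≤ ε ^ 2 * ∫ ω, δ ω ∂μ + ∫ ω, tsq (ε ^ 2) (d ω) ∂μ := by
    calc ∫ ω, δ ω ^ 2 ∂μ ≤ ∫ ω, (ε ^ 2 * δ ω + tsq (ε ^ 2) (d ω) + (-(δ ω * (d ω ^ 2 - σ ω)))) ∂μ := by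
          apply integral_mono_ae hδ2i (((hδi.const_mul _).add hti).add iδY.neg)
          filter_upwards [hδ] with ω h
          have h1 : δ ω ^ 2 ≤ δ ω * σ ω := by nlinarith [h.1, h.2.1]
          have h2 : δ ω * d ω ^ 2 ≤ ε ^ 2 * δ ω + tsq (ε ^ 2) (d ω) := by
            by_cases hc : ε ^ 2 < d ω ^ 2
            · have e : tsq (ε ^ 2) (d ω) = d ω ^ 2 := by simp [tsq, hc]
              rw [e]; nlinarith [h.1, h.2.2, sq_nonneg (d ω), mul_nonneg (sq_nonneg ε) h.1]
            · have := tsq_nonneg (ε ^ 2) (d ω)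
              nlinarith [h.1, not_lt.1 hc]
          simp only [Pi.add_apply, Pi.neg_apply]
          linarith
      _ = _ := by
          rw [integral_add3 (hδi.const_mul _) hti iδYn, integral_const_mul, integral_neg, zδ]; ring
  obtain ⟨i1, z1⟩ := int_mul_zeroC hm hU hU1 hdi hd0
  obtain ⟨i2, z2⟩ := int_mul_zeroC hm hU hU1 hY hY0
  have hUm : AEStronglyMeasurable[m0] U μ := (hU.mono hm).aestronglyMeasurable
  set E : Ω → ℂ := fun ω => Complex.exp (Complex.I * ((t * d ω : ℝ) : ℂ))
        - ((Real.exp (-(t ^ 2 / 2 * δ ω)) : ℝ) : ℂ) with hE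
  have hEm : AEStronglyMeasurable[m0] E μ := by
    apply AEStronglyMeasurable.sub
    · have : Continuous fun x : ℝ => Complex.exp (Complex.I * ((t * x : ℝ) : ℂ)) := by fun_prop
      exact this.comp_aestronglyMeasurable hd.aestronglyMeasurable
    · have : Continuous fun x : ℝ => ((Real.exp (-(t ^ 2 / 2 * x)) : ℝ) : ℂ) := by fun_prop
      exact this.comp_aestronglyMeasurable hδm'
  have hEb : ∀ᵐ ω ∂μ, ‖E ω‖ ≤ 2 := by
    filter_upwards [hδ] with ω h
    refine (norm_sub_le _ _).trans ?_
    have h3 : ‖Complex.exp (Complex.I * ((t * d ω : ℝ) : ℂ))‖ = 1 := by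
      rw [mul_comm]; exact Complex.norm_exp_ofReal_mul_I _
    have h4 : ‖((Real.exp (-(t ^ 2 / 2 * δ ω)) : ℝ) : ℂ)‖ ≤ 1 := by
      rw [Complex.norm_real, Real.norm_of_nonneg (Real.exp_pos _).le]
      apply Real.exp_le_one_iff.2
      have := h.1
      have : 0 ≤ t ^ 2 / 2 * δ ω := by positivity
      linarith
    linarith
  have hEi : Integrable E μ := Integrable.of_bound hEm 2 hEb
  have hUE : Integrable (fun ω => U ω * E ω) μ := hEi.bdd_mul (c := 1) hUm (ae_of_all _ hU1)
  have key : ∫ ω, U ω * E ω ∂μ = ∫ ω, U ω * (E ω - Complex.I * t * (d ω : ℂ)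
      + (t : ℂ) ^ 2 / 2 * ((d ω ^ 2 - σ ω : ℝ) : ℂ)) ∂μ := by
    have e : ∀ ω, U ω * (E ω - Complex.I * t * (d ω : ℂ)
      + (t : ℂ) ^ 2 / 2 * ((d ω ^ 2 - σ ω : ℝ) : ℂ)) = (U ω * E ω - Complex.I * t * (U ω * (d ω : ℂ)))
      + (t : ℂ) ^ 2 / 2 * (U ω * ((d ω ^ 2 - σ ω : ℝ) : ℂ)) := fun ω => by ring
    simp_rw [e]
    have a1 := integral_add (hUE.sub (i1.const_mul (Complex.I * t))) (i2.const_mul ((t : ℂ) ^ 2 / 2))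
    have a2 := integral_sub hUE (i1.const_mul (Complex.I * t))
    refine Eq.trans ?_ a1.symm
    simp only [Pi.sub_apply]
    rw [a2, integral_const_mul, integral_const_mul, z1, z2]
    ring
  rw [key]
  have iσδ : Integrable (fun ω => σ ω - δ ω) μ := hσi.sub hδi
  have ib : Integrable (fun ω => (4 * |t| ^ 3 * ε) * d ω ^ 2 + (4 * t ^ 2) * tsq (ε ^ 2) (d ω)
      + t ^ 2 / 2 * (σ ω - δ ω) + t ^ 4 / 4 * δ ω ^ 2) μ :=
    (((hd2.const_mul _).add (hti.const_mul _)).add ((hσi.sub hδi).const_mul _)).add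
      (hδ2i.const_mul _)
  refine (norm_integral_le_of_norm_le ib ?_).trans ?_
  · filter_upwards [hδ] with ω h
    rw [norm_mul]
    have e : E ω - Complex.I * t * (d ω : ℂ) + (t : ℂ) ^ 2 / 2 * ((d ω ^ 2 - σ ω : ℝ) : ℂ) =
      (Complex.exp (Complex.I * ((t * d ω : ℝ) : ℂ)) - 1 - Complex.I * ((t * d ω : ℝ) : ℂ)
      + ((t * d ω : ℝ) : ℂ) ^ 2 / 2) - (((Real.exp (-(t ^ 2 / 2 * δ ω)) - 1 + t ^ 2 / 2 * δ ω : ℝ)) : ℂ)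
      - ((t ^ 2 / 2 * (σ ω - δ ω) : ℝ) : ℂ) := by
      simp only [hE]; push_cast; ring
    rw [e]
    have b1 := taylor_tsq t (d ω) ε hε
    have hp : 0 ≤ t ^ 2 / 2 * δ ω := mul_nonneg (by positivity) h.1
    have b2 : ‖(((Real.exp (-(t ^ 2 / 2 * δ ω)) - 1 + t ^ 2 / 2 * δ ω : ℝ)) : ℂ)‖ ≤
        (t ^ 2 / 2 * δ ω) ^ 2 := by
      rw [Complex.norm_real]; exact exp_neg_taylor hp
    have b3 : ‖((t ^ 2 / 2 * (σ ω - δ ω) : ℝ) : ℂ)‖ = t ^ 2 / 2 * (σ ω - δ ω) := by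
      rw [Complex.norm_real, Real.norm_of_nonneg]
      exact mul_nonneg (by positivity) (by linarith [h.2.1])
    have b4 := norm_sub_le ((Complex.exp (Complex.I * ((t * d ω : ℝ) : ℂ)) - 1
      - Complex.I * ((t * d ω : ℝ) : ℂ) + ((t * d ω : ℝ) : ℂ) ^ 2 / 2)
      - (((Real.exp (-(t ^ 2 / 2 * δ ω)) - 1 + t ^ 2 / 2 * δ ω : ℝ)) : ℂ))
      ((t ^ 2 / 2 * (σ ω - δ ω) : ℝ) : ℂ)
    have b5 := norm_sub_le (Complex.exp (Complex.I * ((t * d ω : ℝ) : ℂ)) - 1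
      - Complex.I * ((t * d ω : ℝ) : ℂ) + ((t * d ω : ℝ) : ℂ) ^ 2 / 2)
      (((Real.exp (-(t ^ 2 / 2 * δ ω)) - 1 + t ^ 2 / 2 * δ ω : ℝ)) : ℂ)
    refine (mul_le_of_le_one_left (norm_nonneg _) (hU1 ω)).trans ?_
    have e6 : (t ^ 2 / 2 * δ ω) ^ 2 = t ^ 4 / 4 * δ ω ^ 2 := by ring
    linarith
  · rw [integral_add4 (hd2.const_mul _) (hti.const_mul _) (iσδ.const_mul _)
      (hδ2i.const_mul _)]
    simp only [integral_const_mul]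
    have : t ^ 4 / 4 * ∫ ω, δ ω ^ 2 ∂μ ≤
      t ^ 4 / 4 * (ε ^ 2 * ∫ ω, δ ω ∂μ + ∫ ω, tsq (ε ^ 2) (d ω) ∂μ) := by gcongr
    linarith


lemma core [IsProbabilityMeasure μ] {G : Filtration ℕ m0} {d : ℕ → Ω → ℝ} (h : IsMDS G d μ)
    {σ : ℕ → Ω → ℝ} (hσm : ∀ k, StronglyMeasurable[G k] (σ k))
    (hσ : ∀ k, μ[fun ω => d k ω ^ 2 | G k] =ᵐ[μ] σ k) (t ε : ℝ) (hε : 0 ≤ ε) (n : ℕ) :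
    ‖∫ ω, Complex.exp (Complex.I * ((t * ∑ k ∈ Finset.range n, d k ω : ℝ) : ℂ)) ∂μ
        - ((Real.exp (-(t ^ 2 / 2)) : ℝ) : ℂ)‖ ≤
      t ^ 2 / 2 * ∫ ω, (1 - min (∑ k ∈ Finset.range n, σ k ω) 1) ∂μ
      + t ^ 2 / 2 * ∫ ω, (∑ k ∈ Finset.range n, σ k ω - min (∑ k ∈ Finset.range n, σ k ω) 1) ∂μ
      + 4 * |t| ^ 3 * ε * ∑ k ∈ Finset.range n, ∫ ω, d k ω ^ 2 ∂μ
      + t ^ 4 / 4 * ε ^ 2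
      + (4 * t ^ 2 + t ^ 4 / 4) * ∑ k ∈ Finset.range n, ∫ ω, tsq (ε ^ 2) (d k ω) ∂μ := by
  have hσi : ∀ k, Integrable (σ k) μ := fun k => integrable_condExp.congr (hσ k)
  have hσ0 : ∀ k, ∀ᵐ ω ∂μ, 0 ≤ σ k ω := by
    intro k
    have h1 : 0 ≤ᵐ[μ] μ[fun ω => d k ω ^ 2 | G k] :=
      condExp_nonneg (ae_of_all _ fun ω => by positivity)
    filter_upwards [h1, hσ k] with ω a b
    rw [← b]; exact a
  set W : ℕ → Ω → ℝ := fun n ω => ∑ k ∈ Finset.range n, σ k ω with hW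
  set S : ℕ → Ω → ℝ := fun n ω => ∑ k ∈ Finset.range n, d k ω with hS
  have hWs : ∀ n ω, W (n + 1) ω = W n ω + σ n ω := fun n ω => Finset.sum_range_succ _ _
  have hSs : ∀ n ω, S (n + 1) ω = S n ω + d n ω := fun n ω => Finset.sum_range_succ _ _
  have hWm : ∀ n, StronglyMeasurable[G n] (W (n + 1)) := by
    intro n
    apply Finset.stronglyMeasurable_fun_sum
    intro k hk
    exact (hσm k).mono (G.mono (by have := Finset.mem_range.1 hk; omega))
  have hWm' : ∀ n, StronglyMeasurable[G n] (W n) := by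
    intro n
    apply Finset.stronglyMeasurable_fun_sum
    intro k hk
    exact (hσm k).mono (G.mono (by have := Finset.mem_range.1 hk; omega))
  have hWi : ∀ n, Integrable (W n) μ := fun n => integrable_finsetSum _ fun k _ => hσi k
  have hW0 : ∀ n, ∀ᵐ ω ∂μ, 0 ≤ W n ω := by
    intro n
    filter_upwards [ae_all_iff.2 hσ0] with ω hω
    exact Finset.sum_nonneg fun k _ => hω k
  have hmi : ∀ n, Integrable (fun ω => min (W n ω) 1) μ := by
    intro n
    refine integrable_of_bdd ?_ 1 ?_
    · exact ((hWi n).aestronglyMeasurable.inf aestronglyMeasurable_const)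
    · filter_upwards [hW0 n] with ω hω
      rw [abs_of_nonneg (le_min hω zero_le_one)]
      exact min_le_right _ _
  set w : ℕ → Ω → ℝ := fun n ω => Real.exp (-(t ^ 2 / 2 * (1 - min (W n ω) 1))) with hw
  have hw1 : ∀ n ω, 0 ≤ w n ω ∧ w n ω ≤ 1 := by
    intro n ω
    refine ⟨(Real.exp_pos _).le, Real.exp_le_one_iff.2 ?_⟩
    have : 0 ≤ 1 - min (W n ω) 1 := by linarith [min_le_right (W n ω) 1]
    have : 0 ≤ t ^ 2 / 2 * (1 - min (W n ω) 1) := by positivity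
    linarith
  have hwcont : Continuous fun x : ℝ => ((Real.exp (-(t ^ 2 / 2 * (1 - min x 1))) : ℝ) : ℂ) := by
    fun_prop
  have hecont : Continuous fun x : ℝ => Complex.exp (Complex.I * ((t * x : ℝ) : ℂ)) := by
    fun_prop
  set e : ℕ → Ω → ℂ := fun n ω => Complex.exp (Complex.I * ((t * S n ω : ℝ) : ℂ)) with he
  have hen : ∀ n ω, ‖e n ω‖ = 1 := by
    intro n ω
    simp only [he]
    rw [mul_comm]; exact Complex.norm_exp_ofReal_mul_I _
  have hem : ∀ n, StronglyMeasurable[G n] (e n) := fun n =>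
    hecont.comp_stronglyMeasurable (h.sum_meas n)
  have hwm : ∀ n, StronglyMeasurable[G n] fun ω => (w n ω : ℂ) := fun n =>
    hwcont.comp_stronglyMeasurable (hWm' n)
  have hwm1 : ∀ n, StronglyMeasurable[G n] fun ω => (w (n + 1) ω : ℂ) := fun n =>
    hwcont.comp_stronglyMeasurable (hWm n)
  have hφb : ∀ n k ω, ‖e n ω * (w k ω : ℂ)‖ ≤ 1 := by
    intro n k ω
    rw [norm_mul, hen, one_mul, Complex.norm_real, Real.norm_of_nonneg (hw1 k ω).1]
    exact (hw1 k ω).2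
  have hφi : ∀ n, Integrable (fun ω => e n ω * (w n ω : ℂ)) μ := fun n =>
    Integrable.of_bound (((hem n).mul (hwm n)).mono (G.le n)).aestronglyMeasurable 1
      (ae_of_all _ (hφb n n))
  have hei : ∀ n, Integrable (e n) μ := fun n =>
    Integrable.of_bound ((hem n).mono (G.le n)).aestronglyMeasurable 1
      (ae_of_all _ fun ω => (hen n ω).le)
  have main : ∀ n, ‖∫ ω, e n ω * (w n ω : ℂ) ∂μ - ((Real.exp (-(t ^ 2 / 2)) : ℝ) : ℂ)‖ ≤
      t ^ 2 / 2 * ∫ ω, (W n ω - min (W n ω) 1) ∂μ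
      + 4 * |t| ^ 3 * ε * ∑ k ∈ Finset.range n, ∫ ω, d k ω ^ 2 ∂μ
      + t ^ 4 / 4 * (ε ^ 2 * ∫ ω, min (W n ω) 1 ∂μ)
      + (4 * t ^ 2 + t ^ 4 / 4) * ∑ k ∈ Finset.range n, ∫ ω, tsq (ε ^ 2) (d k ω) ∂μ := by
    intro n
    induction n with
    | zero => simp [e, w, W, S]
    | succ n ih =>
      have hminc : Continuous fun x : ℝ => min x 1 := by fun_prop
      have hδn : StronglyMeasurable[G n] (fun ω => min (W (n + 1) ω) 1 - min (W n ω) 1) :=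
        (hminc.comp_stronglyMeasurable (hWm n)).sub (hminc.comp_stronglyMeasurable (hWm' n))
      have hst := step (G.le n) (U := fun ω => e n ω * (w (n + 1) ω : ℂ))
        ((hem n).mul (hwm1 n)) (hφb n (n + 1)) (h.l2 n) (h.cond n) (hσ n) (hσm n)
        (δ := fun ω => min (W (n + 1) ω) 1 - min (W n ω) 1)
        hδn
        (by
          filter_upwards [hσ0 n, hW0 n] with ω h1 h2
          rw [hWs]
          refine ⟨?_, ?_, ?_⟩
          · linarith [min_le_min_right 1 (show W n ω ≤ W n ω + σ n ω by linarith)]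
          · rcases le_total (W n ω) 1 with h3 | h3
            · rw [min_eq_left h3]; linarith [min_le_left (W n ω + σ n ω) 1]
            · rw [min_eq_right h3]; linarith [min_le_right (W n ω + σ n ω) 1]
          · linarith [min_le_right (W n ω + σ n ω) 1, le_min h2 zero_le_one]) t ε hε
      have hd : ∫ ω, e (n + 1) ω * (w (n + 1) ω : ℂ) ∂μ =
          ∫ ω, e n ω * (w n ω : ℂ) ∂μ + ∫ ω, (e n ω * (w (n + 1) ω : ℂ)) *
          (Complex.exp (Complex.I * ((t * d n ω : ℝ) : ℂ))
        - ((Real.exp (-(t ^ 2 / 2 * (min (W (n + 1) ω) 1 - min (W n ω) 1))) : ℝ) : ℂ)) ∂μ := by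
        rw [← sub_eq_iff_eq_add', ← integral_sub (hφi _) (hφi _)]
        apply integral_congr_ae
        refine ae_of_all _ fun ω => ?_
        have e1 : e (n + 1) ω = e n ω * Complex.exp (Complex.I * ((t * d n ω : ℝ) : ℂ)) := by
          simp only [he, hSs]
          rw [← Complex.exp_add]; congr 1; push_cast; ring
        have e2 : w n ω = w (n + 1) ω *
            Real.exp (-(t ^ 2 / 2 * (min (W (n + 1) ω) 1 - min (W n ω) 1))) := by
          simp only [hw]
          rw [← Real.exp_add]; congr 1; ring
        simp only []
        rw [e1, e2]; push_cast; ring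
      rw [hd, add_sub_right_comm]
      refine (norm_add_le _ _).trans ((add_le_add ih hst).trans ?_)
      rw [Finset.sum_range_succ, Finset.sum_range_succ]
      have i1 : Integrable (fun ω => W n ω - min (W n ω) 1) μ := (hWi n).sub (hmi n)
      have i2 : Integrable (fun ω => min (W (n + 1) ω) 1 - min (W n ω) 1) μ :=
        (hmi (n + 1)).sub (hmi n)
      have i3 : Integrable (fun ω => σ n ω - (min (W (n + 1) ω) 1 - min (W n ω) 1)) μ :=
        (hσi n).sub i2
      have E1 : ∫ ω, (W (n + 1) ω - min (W (n + 1) ω) 1) ∂μ = ∫ ω, (W n ω - min (W n ω) 1) ∂μ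
          + ∫ ω, (σ n ω - (min (W (n + 1) ω) 1 - min (W n ω) 1)) ∂μ := by
        rw [← integral_add i1 i3]
        apply integral_congr_ae
        refine ae_of_all _ fun ω => ?_
        simp only [hWs]; ring
      have E2 : ∫ ω, min (W (n + 1) ω) 1 ∂μ = ∫ ω, min (W n ω) 1 ∂μ
          + ∫ ω, (min (W (n + 1) ω) 1 - min (W n ω) 1) ∂μ := by
        rw [integral_sub (hmi _) (hmi _)]; ring
      rw [E1, E2]
      apply le_of_eq
      ring
  have hlast : ‖∫ ω, e n ω ∂μ - ∫ ω, e n ω * (w n ω : ℂ) ∂μ‖ ≤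
      t ^ 2 / 2 * ∫ ω, (1 - min (W n ω) 1) ∂μ := by
    rw [← integral_sub (hei n) (hφi n), ← integral_const_mul]
    have i1 : Integrable (fun ω => t ^ 2 / 2 * (1 - min (W n ω) 1)) μ :=
      ((integrable_const 1).sub (hmi n)).const_mul _
    refine norm_integral_le_of_norm_le i1 (ae_of_all _ fun ω => ?_)
    have : e n ω - e n ω * (w n ω : ℂ) = e n ω * ((1 - w n ω : ℝ) : ℂ) := by push_cast; ring
    rw [this, norm_mul, hen, one_mul, Complex.norm_real, Real.norm_of_nonneg (by linarith [(hw1 n ω).2])]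
    have := Real.add_one_le_exp (-(t ^ 2 / 2 * (1 - min (W n ω) 1)))
    simp only [hw]
    linarith
  have hm1 : ∫ ω, min (W n ω) 1 ∂μ ≤ 1 := by
    calc _ ≤ ∫ _, (1 : ℝ) ∂μ := integral_mono (hmi n) (integrable_const _) fun ω => min_le_right _ _
      _ = 1 := by simp
  have hm2 : t ^ 4 / 4 * (ε ^ 2 * ∫ ω, min (W n ω) 1 ∂μ) ≤ t ^ 4 / 4 * (ε ^ 2 * 1) := by gcongr
  have tri : ‖∫ ω, e n ω ∂μ - ((Real.exp (-(t ^ 2 / 2)) : ℝ) : ℂ)‖ ≤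
      ‖∫ ω, e n ω ∂μ - ∫ ω, e n ω * (w n ω : ℂ) ∂μ‖ +
      ‖∫ ω, e n ω * (w n ω : ℂ) ∂μ - ((Real.exp (-(t ^ 2 / 2)) : ℝ) : ℂ)‖ :=
    norm_sub_le_norm_sub_add_norm_sub _ _ _
  have := main n
  linarith

lemma core' [IsProbabilityMeasure μ] {G : Filtration ℕ m0} {d : ℕ → Ω → ℝ} (h : IsMDS G d μ)
    {σ : ℕ → Ω → ℝ} (hσm : ∀ k, StronglyMeasurable[G k] (σ k))
    (hσ : ∀ k, μ[fun ω => d k ω ^ 2 | G k] =ᵐ[μ] σ k) (t ε : ℝ) (hε : 0 ≤ ε) (n : ℕ)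
    (h1 : ∑ k ∈ Finset.range n, ∫ ω, d k ω ^ 2 ∂μ = 1) :
    ‖∫ ω, Complex.exp (Complex.I * ((t * ∑ k ∈ Finset.range n, d k ω : ℝ) : ℂ)) ∂μ
        - ((Real.exp (-(t ^ 2 / 2)) : ℝ) : ℂ)‖ ≤
      t ^ 2 * ∫ ω, (1 - min (∑ k ∈ Finset.range n, σ k ω) 1) ∂μ
      + 4 * |t| ^ 3 * ε + t ^ 4 / 4 * ε ^ 2
      + (4 * t ^ 2 + t ^ 4 / 4) * ∑ k ∈ Finset.range n, ∫ ω, tsq (ε ^ 2) (d k ω) ∂μ := by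
  have hc := core h hσm hσ t ε hε n
  have hσi : ∀ k, Integrable (σ k) μ := fun k => integrable_condExp.congr (hσ k)
  have hWi : Integrable (fun ω => ∑ k ∈ Finset.range n, σ k ω) μ :=
    integrable_finsetSum _ fun k _ => hσi k
  have hI : ∫ ω, ∑ k ∈ Finset.range n, σ k ω ∂μ = 1 := by
    rw [integral_finsetSum _ fun k _ => hσi k, ← h1]
    refine Finset.sum_congr rfl fun k _ => ?_
    rw [← integral_congr_ae (hσ k), integral_condExp (G.le k)]
  have hmi : Integrable (fun ω => min (∑ k ∈ Finset.range n, σ k ω) 1) μ :=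
    hWi.inf (integrable_const 1)
  rw [integral_sub hWi hmi, hI, h1] at hc
  rw [integral_sub (integrable_const _) hmi] at hc ⊢
  simp only [integral_const, probReal_univ, smul_eq_mul, mul_one] at hc ⊢
  linarith


lemma cs [IsProbabilityMeasure μ] {f g : Ω → ℝ} (hf : MemLp f 2 μ) (hg : MemLp g 2 μ) :
    |∫ ω, f ω * g ω ∂μ| ≤ √(∫ ω, f ω ^ 2 ∂μ) * √(∫ ω, g ω ^ 2 ∂μ) := by
  have hfg : Integrable (fun ω => f ω * g ω) μ := hf.integrable_mul hg
  have h : ∀ x : ℝ, 0 ≤ (∫ ω, g ω ^ 2 ∂μ) * (x * x) + (2 * ∫ ω, f ω * g ω ∂μ) * x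
      + ∫ ω, f ω ^ 2 ∂μ := by
    intro x
    have e : ∫ ω, (f ω + x * g ω) ^ 2 ∂μ = ∫ ω, (x * x * g ω ^ 2 + (2 * x) * (f ω * g ω)
        + f ω ^ 2) ∂μ := by
      congr 1; ext ω; ring
    rw [integral_add3 (hg.integrable_sq.const_mul _) (hfg.const_mul _) hf.integrable_sq,
      integral_const_mul, integral_const_mul] at e
    have : 0 ≤ ∫ ω, (f ω + x * g ω) ^ 2 ∂μ := integral_nonneg fun ω => by positivity
    nlinarith
  have d := discrim_le_zero h
  rw [discrim] at d
  have h1 : 0 ≤ ∫ ω, f ω ^ 2 ∂μ := integral_nonneg fun ω => by positivity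
  rw [← Real.sqrt_mul h1]
  apply Real.abs_le_sqrt
  nlinarith

lemma l1_le_l2 [IsProbabilityMeasure μ] {f : Ω → ℝ} (hf : MemLp f 2 μ) :
    ∫ ω, |f ω| ∂μ ≤ √(∫ ω, f ω ^ 2 ∂μ) := by
  have := cs hf.abs (memLp_const (1 : ℝ))
  simp at this
  exact (le_abs_self _).trans this

lemma l2_tri [IsProbabilityMeasure μ] {f g : Ω → ℝ} (hf : MemLp f 2 μ) (hg : MemLp g 2 μ) :
    √(∫ ω, (f ω + g ω) ^ 2 ∂μ) ≤ √(∫ ω, f ω ^ 2 ∂μ) + √(∫ ω, g ω ^ 2 ∂μ) := by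
  have hfg : Integrable (fun ω => f ω * g ω) μ := hf.integrable_mul hg
  have e : ∫ ω, (f ω + g ω) ^ 2 ∂μ = ∫ ω, (f ω ^ 2 + 2 * (f ω * g ω) + g ω ^ 2) ∂μ := by
    congr 1; ext ω; ring
  rw [integral_add3 hf.integrable_sq (hfg.const_mul _) hg.integrable_sq,
      integral_const_mul] at e
  apply Real.sqrt_le_iff.2 ⟨by positivity, ?_⟩
  have h1 : 0 ≤ ∫ ω, f ω ^ 2 ∂μ := integral_nonneg fun ω => by positivity
  have h2 : 0 ≤ ∫ ω, g ω ^ 2 ∂μ := integral_nonneg fun ω => by positivity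
  have := (le_abs_self _).trans (cs hf hg)
  rw [e, add_sq, Real.sq_sqrt h1, Real.sq_sqrt h2]
  linarith

lemma l2_tri' [IsProbabilityMeasure μ] {f g : Ω → ℝ} (hf : MemLp f 2 μ) (hg : MemLp g 2 μ) :
    |√(∫ ω, (f ω + g ω) ^ 2 ∂μ) - √(∫ ω, f ω ^ 2 ∂μ)| ≤ √(∫ ω, g ω ^ 2 ∂μ) := by
  have h1 := l2_tri hf hg
  have h2 := l2_tri (hf.add hg) hg.neg
  simp at h2
  rw [abs_le]; constructor <;> linarith

lemma cexp_lip (x y : ℝ) :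
    ‖Complex.exp (Complex.I * (x : ℂ)) - Complex.exp (Complex.I * (y : ℂ))‖ ≤ |x - y| := by
  have e : Complex.exp (Complex.I * (x : ℂ)) - Complex.exp (Complex.I * (y : ℂ)) =
      Complex.exp ((y : ℂ) * Complex.I) * (Complex.exp (Complex.I * ((x - y : ℝ) : ℂ)) - 1) := by
    rw [mul_sub, ← Complex.exp_add, mul_one]
    congr 2
    · push_cast; ring
    · ring
  rw [e, norm_mul, Complex.norm_exp_ofReal_mul_I, one_mul]
  exact Real.norm_exp_I_mul_ofReal_sub_one_le

lemma char_lip [IsProbabilityMeasure μ] {f g : Ω → ℝ} (hf : MemLp f 2 μ) (hg : MemLp g 2 μ)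
    (t : ℝ) :
    ‖∫ ω, Complex.exp (Complex.I * ((t * f ω : ℝ) : ℂ)) ∂μ
      - ∫ ω, Complex.exp (Complex.I * ((t * g ω : ℝ) : ℂ)) ∂μ‖ ≤ |t| * ∫ ω, |f ω - g ω| ∂μ := by
  have key : ∀ {f : Ω → ℝ}, MemLp f 2 μ →
      Integrable (fun ω => Complex.exp (Complex.I * ((t * f ω : ℝ) : ℂ))) μ := by
    intro f hf
    refine Integrable.of_bound ?_ 1 ?_
    · have hc : Continuous fun x : ℝ => Complex.exp (Complex.I * ((t * x : ℝ) : ℂ)) := by fun_prop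
      exact hc.comp_aestronglyMeasurable hf.aestronglyMeasurable
    · refine ae_of_all _ fun ω => ?_
      rw [mul_comm, Complex.norm_exp_ofReal_mul_I]
  rw [← integral_sub (key hf) (key hg), ← integral_const_mul]
  refine norm_integral_le_of_norm_le
    (((hf.sub hg).integrable (by norm_num)).abs.const_mul _) (ae_of_all _ fun ω => ?_)
  refine (cexp_lip _ _).trans ?_
  rw [← mul_sub, abs_mul]

/-- The comparison of the two normalised sums. -/
lemma norm_cmp [IsProbabilityMeasure μ] {B G : Ω → ℝ} (hB : MemLp B 2 μ) (hG : MemLp G 2 μ)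
    {s σ g : ℝ} (hs : s = √(∫ ω, (B ω + G ω) ^ 2 ∂μ)) (hσ : σ = √(∫ ω, B ω ^ 2 ∂μ))
    (hg : √(∫ ω, G ω ^ 2 ∂μ) ≤ g) (hs0 : 0 < s) (hσ0 : 0 < σ) (t : ℝ) :
    ‖∫ ω, Complex.exp (Complex.I * ((t * ((B ω + G ω) / s) : ℝ) : ℂ)) ∂μ
      - ∫ ω, Complex.exp (Complex.I * ((t * (B ω / σ) : ℝ) : ℂ)) ∂μ‖ ≤ |t| * (2 * (g / s)) := by
  have h1 : MemLp (fun ω => (B ω + G ω) / s) 2 μ := by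
    simp_rw [div_eq_inv_mul]; exact (hB.add hG).const_mul _
  have h2 : MemLp (fun ω => B ω / σ) 2 μ := by
    simp_rw [div_eq_inv_mul]; exact hB.const_mul _
  refine (char_lip h1 h2 t).trans ?_
  gcongr
  have hBi := (hB.integrable (by norm_num : (1 : ENNReal) ≤ 2)).abs
  have hGi := (hG.integrable (by norm_num : (1 : ENNReal) ≤ 2)).abs
  have h3 : ∫ ω, |(B ω + G ω) / s - B ω / σ| ∂μ ≤
      ∫ ω, (1 / s * |G ω| + |1 / s - 1 / σ| * |B ω|) ∂μ := by
    refine integral_mono_of_nonneg (ae_of_all _ fun ω => abs_nonneg _)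
      ((hGi.const_mul _).add (hBi.const_mul _)) (ae_of_all _ fun ω => ?_)
    have : (B ω + G ω) / s - B ω / σ = 1 / s * G ω + (1 / s - 1 / σ) * B ω := by ring
    simp only [this]
    refine (abs_add_le _ _).trans ?_
    rw [abs_mul, abs_mul, abs_of_pos (by positivity : 0 < 1 / s)]
  rw [integral_add (hGi.const_mul _) (hBi.const_mul _), integral_const_mul,
    integral_const_mul] at h3
  have h4 := l1_le_l2 hB
  have h5 := l1_le_l2 hG
  have h6 := l2_tri' hB hG
  rw [← hs, ← hσ] at h6
  rw [← hσ] at h4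
  have h7 : |1 / s - 1 / σ| * σ = |s - σ| / s := by
    have : 1 / s - 1 / σ = -((s - σ) / (s * σ)) := by field_simp; ring
    rw [this, abs_neg, abs_div, abs_of_pos (by positivity : 0 < s * σ)]
    field_simp
  calc _ ≤ _ := h3
    _ ≤ 1 / s * g + |1 / s - 1 / σ| * σ := by gcongr; exact h5.trans hg
    _ ≤ 1 / s * g + g / s := by rw [h7]; gcongr; exact h6.trans hg
    _ = _ := by ring

/-- The `j`-th block sum. -/
noncomputable def blk (X : ℕ → Ω → ℝ) (b T j : ℕ) (ω : Ω) : ℝ :=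
  ∑ t ∈ Finset.Icc (j * b + 2) (min ((j + 1) * b) T), X t ω

lemma blk_eq (X : ℕ → Ω → ℝ) (b T j : ℕ) (ω : Ω) :
    blk X b T j ω = ∑ i ∈ Finset.range (min ((j + 1) * b) T + 1 - (j * b + 2)),
      X (j * b + 2 + i) ω := by
  rw [blk, ← Finset.sum_Ico_eq_sum_range (fun t => X t ω)]
  congr 1

lemma cond_zero (ℱ : Filtration ℕ m0) (X : ℕ → Ω → ℝ)
    (hlag2 : ∀ t, 2 ≤ t → μ[X t | ℱ (t - 2)] =ᵐ[μ] 0) [IsProbabilityMeasure μ]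
    (s t : ℕ) (h : s + 2 ≤ t) : μ[X t | ℱ s] =ᵐ[μ] 0 := by
  have h1 : μ[μ[X t | ℱ (t - 2)] | ℱ s] =ᵐ[μ] μ[X t | ℱ s] :=
    condExp_condExp_of_le (ℱ.mono (by omega)) (ℱ.le _)
  have h2 : μ[μ[X t | ℱ (t - 2)] | ℱ s] =ᵐ[μ] μ[(0 : Ω → ℝ) | ℱ s] :=
    condExp_congr_ae (hlag2 t (by omega))
  rw [condExp_zero] at h2
  exact h1.symm.trans h2

lemma blk_mds [IsProbabilityMeasure μ] (ℱ : Filtration ℕ m0) (X : ℕ → Ω → ℝ)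
    (hmeas : ∀ t, 2 ≤ t → StronglyMeasurable[ℱ t] (X t))
    (hL2 : ∀ t, 2 ≤ t → MemLp (X t) 2 μ)
    (hlag2 : ∀ t, 2 ≤ t → μ[X t | ℱ (t - 2)] =ᵐ[μ] 0) (b T : ℕ) :
    IsMDS (subF ℱ (fun k => k * b) (fun _ _ hij => Nat.mul_le_mul_right b hij))
      (blk X b T) μ where
  meas k := by
    apply Finset.stronglyMeasurable_fun_sum
    intro t ht
    have := Finset.mem_Icc.1 ht
    exact (hmeas t (by omega)).mono (ℱ.mono (by simp at this ⊢; omega))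
  l2 k := by
    apply memLp_finsetSum
    intro t ht
    have := Finset.mem_Icc.1 ht
    exact hL2 t (by omega)
  cond k := by
    have e : blk X b T k = ∑ t ∈ Finset.Icc (k * b + 2) (min ((k + 1) * b) T), X t := by
      ext ω; simp [blk]
    rw [e]
    have h1 := condExp_finsetSum (μ := μ)
      (s := Finset.Icc (k * b + 2) (min ((k + 1) * b) T)) (f := X)
      (fun t ht => (hL2 t (by have := Finset.mem_Icc.1 ht; omega)).integrable (by norm_num))
      (ℱ (k * b))
    refine h1.trans ?_
    have h2 : ∀ᵐ ω ∂μ, ∀ t ∈ Finset.Icc (k * b + 2) (min ((k + 1) * b) T),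
        (μ[X t | ℱ (k * b)]) ω = 0 := by
      rw [Filter.eventually_all_finset]
      intro t ht
      exact cond_zero ℱ X hlag2 (k * b) t (by have := Finset.mem_Icc.1 ht; omega)
    filter_upwards [h2] with ω hω
    simp only [Finset.sum_apply, Pi.zero_apply]
    exact Finset.sum_eq_zero hω

lemma gap_mds [IsProbabilityMeasure μ] (ℱ : Filtration ℕ m0) (X : ℕ → Ω → ℝ)
    (hmeas : ∀ t, 2 ≤ t → StronglyMeasurable[ℱ t] (X t))
    (hL2 : ∀ t, 2 ≤ t → MemLp (X t) 2 μ)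
    (hlag2 : ∀ t, 2 ≤ t → μ[X t | ℱ (t - 2)] =ᵐ[μ] 0) (b : ℕ) (hb : 2 ≤ b) :
    IsMDS (subF ℱ (fun k => b * (k + 1) - 1) (fun i j hij => by
      have : b * (i + 1) ≤ b * (j + 1) := Nat.mul_le_mul_left b (by omega)
      simp only; omega))
      (fun k => X (b * (k + 1) + 1)) μ where
  meas k := by
    have h1 : b * (k + 1 + 1) = b * (k + 1) + b := by ring
    have h2 : b * (k + 1) = b * k + b := by ring
    exact (hmeas _ (by omega)).mono (ℱ.mono (by simp only; omega))
  l2 k := by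
    have h2 : b * (k + 1) = b * k + b := by ring
    exact hL2 _ (by omega)
  cond k := by
    have h2 : b * (k + 1) = b * k + b := by ring
    exact cond_zero ℱ X hlag2 _ _ (by simp only; omega)

lemma sum_decomp (a : ℕ → ℝ) (b T : ℕ) (hb : 2 ≤ b) (n : ℕ) (hn : (n - 1) * b < T) :
    ∑ t ∈ Finset.Icc 2 (min (n * b) T), a t =
      ∑ j ∈ Finset.range n, ∑ t ∈ Finset.Icc (j * b + 2) (min ((j + 1) * b) T), a t
      + ∑ k ∈ Finset.range (n - 1), a (b * (k + 1) + 1) := by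
  induction n with
  | zero => simp
  | succ n ih =>
    rw [Finset.sum_range_succ]
    rcases Nat.eq_zero_or_pos n with h0 | h0
    · subst h0; simp
    · obtain ⟨m, rfl⟩ : ∃ m, n = m + 1 := ⟨n - 1, by omega⟩
      simp only [Nat.add_sub_cancel] at hn ih ⊢
      have e1 : (m + 1) * b = m * b + b := by ring
      have e2 : (m + 1 + 1) * b = m * b + b + b := by ring
      rw [Finset.sum_range_succ (fun k => a (b * (k + 1) + 1)) m]
      have ih' := ih (by omega)
      rw [min_eq_left (by omega)] at ih'
      have c : ∀ p q, Finset.Icc p q = Finset.Ico p (q + 1) := fun p q => by ext; simp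
      have e3 : ∑ t ∈ Finset.Icc 2 (min ((m + 1 + 1) * b) T), a t =
          ∑ t ∈ Finset.Icc 2 ((m + 1) * b), a t + a (b * (m + 1) + 1) +
          ∑ t ∈ Finset.Icc ((m + 1) * b + 2) (min ((m + 1 + 1) * b) T), a t := by
        rw [c, c, c, ← Finset.sum_Ico_consecutive a (n := (m + 1) * b + 2) (by omega) (by omega),
          Finset.sum_Ico_succ_top (by omega), mul_comm b (m + 1)]
      rw [e3, ih']; ring

/-- `J = ⌈T/b⌉` in natural-number terms. -/
lemma ceil_facts (b T : ℕ) (hb : 0 < b) (hT : 0 < T) :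
    0 < ⌈(T : ℝ) / (b : ℝ)⌉₊ ∧ (⌈(T : ℝ) / (b : ℝ)⌉₊ - 1) * b < T ∧ T ≤ ⌈(T : ℝ) / (b : ℝ)⌉₊ * b := by
  have hb' : (0 : ℝ) < b := by exact_mod_cast hb
  have hT' : (0 : ℝ) < T := by exact_mod_cast hT
  have h0 : 0 < ⌈(T : ℝ) / (b : ℝ)⌉₊ := Nat.ceil_pos.2 (by positivity)
  refine ⟨h0, ?_, ?_⟩
  · have : ⌈(T : ℝ) / (b : ℝ)⌉₊ - 1 < ⌈(T : ℝ) / (b : ℝ)⌉₊ := by omega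
    rw [Nat.lt_ceil, lt_div_iff₀ hb'] at this
    exact_mod_cast this
  · have := Nat.le_ceil ((T : ℝ) / (b : ℝ))
    rw [div_le_iff₀ hb'] at this
    exact_mod_cast this

/-- A nonasymptotic bound on the truncated second moments. -/
lemma lind_bound [IsProbabilityMeasure μ] (ℱ : Filtration ℕ m0) (X : ℕ → Ω → ℝ)
    (hmeas : ∀ t, 2 ≤ t → StronglyMeasurable[ℱ t] (X t))
    (hL2 : ∀ t, 2 ≤ t → MemLp (X t) 2 μ)
    (hlag2 : ∀ t, 2 ≤ t → μ[X t | ℱ (t - 2)] =ᵐ[μ] 0)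
    {M K η ε σ : ℝ} (hM : 0 ≤ M) (hK : 0 ≤ K) (hη : 0 ≤ η) (hε : 0 < ε) (hσ : 0 < σ)
    (b T J : ℕ)
    (hv : ∀ t, 2 ≤ t → t ≤ T → ∫ ω, (X t ω) ^ 2 ∂μ ≤ M)
    (hU : ∀ t, 2 ≤ t →
      ∫ ω, tsq (K * ∫ ω, (X t ω) ^ 2 ∂μ) (X t ω) ∂μ ≤ η * ∫ ω, (X t ω) ^ 2 ∂μ) :
    ∑ j ∈ Finset.range J, ∫ ω, tsq (ε ^ 2) (blk X b T j ω / σ) ∂μ ≤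
      32768 * (K ^ 2 / ε ^ 2) * ((J * (b * M / σ ^ 2)) * (b * M / σ ^ 2))
        + 32 * η * (J * (b * M / σ ^ 2)) := by
  have h1 : ∀ j ∈ Finset.range J, ∫ ω, tsq (ε ^ 2) (blk X b T j ω / σ) ∂μ ≤
      1 / σ ^ 2 * (32768 * ((b : ℝ) ^ 2 * (K * M) ^ 2 / (ε ^ 2 * σ ^ 2)) + 32 * (b * (η * M))) := by
    intro j _
    have e : ∀ x : ℝ, tsq (ε ^ 2) (x / σ) = 1 / σ ^ 2 * tsq (ε ^ 2 * σ ^ 2) x := by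
      intro x
      unfold tsq
      rw [div_pow]
      by_cases h : ε ^ 2 * σ ^ 2 < x ^ 2
      · rw [if_pos h, if_pos ((lt_div_iff₀ (by positivity)).2 h)]; ring
      · rw [if_neg h, if_neg (fun h' => h ((lt_div_iff₀ (by positivity)).1 h'))]; ring
    simp_rw [e]
    rw [integral_const_mul]
    gcongr
    simp_rw [blk_eq]
    set n := min ((j + 1) * b) T + 1 - (j * b + 2) with hn
    have ej : (j + 1) * b = j * b + b := by ring
    have hnb : n ≤ b := by omega
    refine (block_lind ℱ X hmeas hL2 hlag2 hM hK hη (L := ε ^ 2 * σ ^ 2) (by positivity)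
      (j * b + 2) n (by omega) (fun i hi => hv _ (by omega) (by omega)) hU).trans ?_
    gcongr
  refine (Finset.sum_le_sum h1).trans (le_of_eq ?_)
  simp only [Finset.sum_const, Finset.card_range, nsmul_eq_mul]
  field_simp

/-- Conversion of the uniform integrability hypothesis. -/
lemma ui_conv [IsProbabilityMeasure μ] (X : ℕ → Ω → ℝ)
    (hL2 : ∀ t, 2 ≤ t → MemLp (X t) 2 μ)
    (hUI : ∀ ε > (0 : ℝ), ∃ K : ℝ, ∀ t, 2 ≤ t →
      ∫ ω in {ω | K ≤ (X t ω) ^ 2 / (∫ ω', (X t ω') ^ 2 ∂μ)},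
        (X t ω) ^ 2 / (∫ ω', (X t ω') ^ 2 ∂μ) ∂μ ≤ ε) (η : ℝ) (hη : 0 < η) :
    ∃ K : ℝ, 0 ≤ K ∧ ∀ t, 2 ≤ t →
      ∫ ω, tsq (K * ∫ ω, (X t ω) ^ 2 ∂μ) (X t ω) ∂μ ≤ η * ∫ ω, (X t ω) ^ 2 ∂μ := by
  obtain ⟨K, hK⟩ := hUI η hη
  refine ⟨max K 0, le_max_right _ _, fun t ht => ?_⟩
  have hv0 : 0 ≤ ∫ ω, (X t ω) ^ 2 ∂μ := integral_nonneg fun ω => by positivity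
  rcases hv0.eq_or_lt with h0 | hpos
  · calc _ ≤ ∫ ω, (X t ω) ^ 2 ∂μ := integral_mono (integrable_tsq (hL2 t ht) _)
          (hL2 t ht).integrable_sq fun ω => tsq_le_sq _ _
      _ = _ := by rw [← h0]; ring
  · have h1 := hK t ht
    set v := ∫ ω, (X t ω) ^ 2 ∂μ with hv
    set A : Set Ω := {ω | K ≤ (X t ω) ^ 2 / v} with hA
    have hAm : NullMeasurableSet A μ := by
      have : AEMeasurable (fun ω => (X t ω) ^ 2 / v) μ :=
        ((hL2 t ht).aestronglyMeasurable.aemeasurable.pow_const 2).div_const v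
      exact nullMeasurableSet_le aemeasurable_const this
    have hdiv : ∫ ω in A, (X t ω) ^ 2 / v ∂μ = (∫ ω in A, (X t ω) ^ 2 ∂μ) / v := integral_div _ _
    rw [hdiv, div_le_iff₀ hpos] at h1
    refine le_trans ?_ h1
    rw [← integral_indicator₀ hAm]
    refine integral_mono (integrable_tsq (hL2 t ht) _)
      ((hL2 t ht).integrable_sq.indicator₀ hAm) fun ω => ?_
    unfold tsq
    split_ifs with h
    · have : ω ∈ A := by
        rw [hA, Set.mem_ofPred_eq, le_div_iff₀ hpos]
        exact (mul_le_mul_of_nonneg_right (le_max_left K 0) hpos.le).trans h.le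
      rw [Set.indicator_of_mem this]
    · exact Set.indicator_nonneg (fun ω _ => by positivity) ω

/-- The blockwise predictable variance. -/
noncomputable def pv (ℱ : Filtration ℕ m0) (X : ℕ → Ω → ℝ) (μ : Measure Ω) (b T J : ℕ) (ω : Ω) : ℝ :=
  ∑ j ∈ Finset.range J, (μ[fun ω' => blk X b T j ω' ^ 2 | ℱ (j * b)]) ω

lemma pv_int [IsProbabilityMeasure μ] (ℱ : Filtration ℕ m0) (X : ℕ → Ω → ℝ) (b T J : ℕ) :
    ∫ ω, pv ℱ X μ b T J ω ∂μ = ∑ j ∈ Finset.range J, ∫ ω, blk X b T j ω ^ 2 ∂μ := by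
  unfold pv
  rw [integral_finsetSum _ fun j _ => integrable_condExp]
  exact Finset.sum_congr rfl fun j _ => integral_condExp (ℱ.le _)

lemma fixedT [IsProbabilityMeasure μ] (ℱ : Filtration ℕ m0) (X : ℕ → Ω → ℝ)
    (hmeas : ∀ t, 2 ≤ t → StronglyMeasurable[ℱ t] (X t))
    (hL2 : ∀ t, 2 ≤ t → MemLp (X t) 2 μ)
    (hlag2 : ∀ t, 2 ≤ t → μ[X t | ℱ (t - 2)] =ᵐ[μ] 0)
    {M K η ε s C : ℝ} (hM : 0 ≤ M) (hK : 0 ≤ K) (hη : 0 ≤ η) (hε : 0 < ε) (hs : 0 < s)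
    (b T J : ℕ) (hb : 2 ≤ b) (hbT : b ≤ T) (hJ0 : 0 < J) (hJ1 : (J - 1) * b < T)
    (hJ2 : T ≤ J * b)
    (hv : ∀ t, 2 ≤ t → t ≤ T → ∫ ω, (X t ω) ^ 2 ∂μ ≤ M)
    (hU : ∀ t, 2 ≤ t →
      ∫ ω, tsq (K * ∫ ω, (X t ω) ^ 2 ∂μ) (X t ω) ∂μ ≤ η * ∫ ω, (X t ω) ^ 2 ∂μ)
    (hs2 : s = √(∫ ω, (∑ t ∈ Finset.Icc 2 T, X t ω) ^ 2 ∂μ))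
    (hC0 : 0 ≤ C) (hC : T * M ≤ C * s ^ 2) (hCb : C / b ≤ 1 / 4) (t : ℝ) :
    ‖∫ ω, Complex.exp (Complex.I * ((t * ((∑ t ∈ Finset.Icc 2 T, X t ω) / s) : ℝ) : ℂ)) ∂μ
        - ((Real.exp (-(t ^ 2 / 2)) : ℝ) : ℂ)‖ ≤
      |t| * (2 * √(C / b))
      + (t ^ 2 * ∫ ω, (1 - min (pv ℱ X μ b T J ω / ∫ ω, pv ℱ X μ b T J ω ∂μ) 1) ∂μ
      + 4 * |t| ^ 3 * ε + t ^ 4 / 4 * ε ^ 2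
      + (4 * t ^ 2 + t ^ 4 / 4) *
        (32768 * (K ^ 2 / ε ^ 2) * (32 * C ^ 2 * (b / T)) + 256 * C * η)) := by
  have hbR : (0 : ℝ) < b := by exact_mod_cast (by omega : 0 < b)
  have hTR : (0 : ℝ) < T := by exact_mod_cast (by omega : 0 < T)
  have hBM := blk_mds ℱ X hmeas hL2 hlag2 b T
  have hGM := gap_mds ℱ X hmeas hL2 hlag2 b hb
  set B : Ω → ℝ := fun ω => ∑ j ∈ Finset.range J, blk X b T j ω with hB
  set G : Ω → ℝ := fun ω => ∑ k ∈ Finset.range (J - 1), X (b * (k + 1) + 1) ω with hG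
  have hBl : MemLp B 2 μ := hBM.sum_l2 J
  have hGl : MemLp G 2 μ := hGM.sum_l2 (J - 1)
  have hS : ∀ ω, ∑ t ∈ Finset.Icc 2 T, X t ω = B ω + G ω := by
    intro ω
    have := sum_decomp (fun t => X t ω) b T hb J hJ1
    rw [min_eq_right hJ2] at this
    exact this
  simp_rw [hS] at hs2 ⊢
  -- the gap part
  have hG2 : ∫ ω, G ω ^ 2 ∂μ ≤ C / b * s ^ 2 := by
    calc _ = ∑ k ∈ Finset.range (J - 1), ∫ ω, X (b * (k + 1) + 1) ω ^ 2 ∂μ := hGM.sq_sum _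
      _ ≤ ∑ k ∈ Finset.range (J - 1), M := by
        refine Finset.sum_le_sum fun k hk => hv _ (by nlinarith) ?_
        have h1 : k + 1 ≤ J - 1 := by have := Finset.mem_range.1 hk; omega
        have h2 := Nat.mul_le_mul_right b h1
        rw [mul_comm b]; omega
      _ = ((J - 1 : ℕ) : ℝ) * M := by simp
      _ ≤ (T / b : ℝ) * M := by
        gcongr
        rw [le_div_iff₀ hbR]
        exact_mod_cast hJ1.le
      _ = (T * M) / b := by ring
      _ ≤ (C * s ^ 2) / b := by gcongr
      _ = _ := by ring
  have hg : √(∫ ω, G ω ^ 2 ∂μ) ≤ √(C / b) * s := by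
    calc _ ≤ √(C / b * s ^ 2) := Real.sqrt_le_sqrt hG2
      _ = _ := by rw [Real.sqrt_mul (by positivity), Real.sqrt_sq hs.le]
  have hhalf : √(C / b) ≤ 1 / 2 := by
    rw [Real.sqrt_le_left (by norm_num)]; linarith
  set σ := √(∫ ω, B ω ^ 2 ∂μ) with hσ
  have hσs : s / 2 ≤ σ := by
    have h1 := l2_tri' hBl hGl
    rw [← hs2, ← hσ] at h1
    have h2 := (le_abs_self _).trans (h1.trans hg)
    have : √(C / b) * s ≤ 1 / 2 * s := by gcongr
    linarith
  have hσ0 : 0 < σ := by linarith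
  have hσ2 : σ ^ 2 = ∑ j ∈ Finset.range J, ∫ ω, blk X b T j ω ^ 2 ∂μ := by
    rw [hσ, Real.sq_sqrt (integral_nonneg fun ω => by positivity)]
    exact hBM.sq_sum J
  have hpvi : ∫ ω, pv ℱ X μ b T J ω ∂μ = σ ^ 2 := by rw [pv_int, hσ2]
  have c1 := norm_cmp hBl hGl hs2 hσ hg hs hσ0 t
  rw [mul_div_assoc, div_self hs.ne', mul_one] at c1
  -- the martingale part
  have hdM : IsMDS (subF ℱ (fun k => k * b) (fun _ _ hij => Nat.mul_le_mul_right b hij))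
      (fun j ω => blk X b T j ω / σ) μ := by
    refine ⟨fun k => ?_, fun k => ?_, fun k => ?_⟩
    · simp_rw [div_eq_mul_inv]
      exact (hBM.meas k).mul_const _
    · simp_rw [div_eq_inv_mul]; exact (hBM.l2 k).const_mul _
    · have e : (fun ω => blk X b T k ω / σ) = σ⁻¹ • blk X b T k := by
        ext ω; simp [div_eq_inv_mul]
      rw [e]
      refine (condExp_smul _ _ _).trans ?_
      filter_upwards [hBM.cond k] with ω hω
      simp [hω]
  have hcond : ∀ k, μ[fun ω => (blk X b T k ω / σ) ^ 2 | ℱ (k * b)] =ᵐ[μ]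
      fun ω => (μ[fun ω' => blk X b T k ω' ^ 2 | ℱ (k * b)]) ω / σ ^ 2 := by
    intro k
    have e : (fun ω => (blk X b T k ω / σ) ^ 2) = (σ ^ 2)⁻¹ • fun ω' => blk X b T k ω' ^ 2 := by
      ext ω; simp [div_eq_inv_mul, mul_pow]
    rw [e]
    refine (condExp_smul _ _ _).trans ?_
    refine ae_of_all _ fun ω => ?_
    simp [div_eq_inv_mul]
  have c2 := core' hdM
    (σ := fun k ω => (μ[fun ω' => blk X b T k ω' ^ 2 | ℱ (k * b)]) ω / σ ^ 2)
    (fun k => by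
      simp_rw [div_eq_mul_inv]
      exact (stronglyMeasurable_condExp).mul_const _)
    hcond t ε hε.le J (by
      simp_rw [div_pow]
      simp_rw [integral_div]
      rw [← Finset.sum_div, ← hσ2, div_self (by positivity)])
  simp_rw [← Finset.sum_div] at c2
  have c3 := lind_bound ℱ X hmeas hL2 hlag2 hM hK hη hε hσ0 b T J hv hU
  have x0 : 0 ≤ b * M / σ ^ 2 := by positivity
  have hCs : T * M ≤ 4 * C * σ ^ 2 := by
    have : s ^ 2 ≤ 4 * σ ^ 2 := by nlinarith
    nlinarith
  have x1 : b * M / σ ^ 2 ≤ 4 * C * (b / T) := by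
    rw [div_le_iff₀ (by positivity)]
    calc b * M = (T * M) * (b / T) := by field_simp
      _ ≤ (4 * C * σ ^ 2) * (b / T) := by gcongr
      _ = _ := by ring
  have hJb : (J : ℝ) * b ≤ 2 * T := by
    have : J * b = (J - 1) * b + b := by
      obtain ⟨m, rfl⟩ : ∃ m, J = m + 1 := ⟨J - 1, by omega⟩
      simp; ring
    have : J * b ≤ 2 * T := by omega
    exact_mod_cast this
  have x2 : J * (b * M / σ ^ 2) ≤ 8 * C := by
    rw [← mul_div_assoc, div_le_iff₀ (by positivity)]
    calc J * (b * M) = (J * b) * M := by ring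
      _ ≤ 2 * T * M := by gcongr
      _ ≤ _ := by linarith
  have c4 : ∑ j ∈ Finset.range J, ∫ ω, tsq (ε ^ 2) (blk X b T j ω / σ) ∂μ ≤
      32768 * (K ^ 2 / ε ^ 2) * (32 * C ^ 2 * (b / T)) + 256 * C * η := by
    refine c3.trans ?_
    have y1 : J * (b * M / σ ^ 2) * (b * M / σ ^ 2) ≤ 32 * C ^ 2 * (b / T) := by
      calc _ ≤ (8 * C) * (4 * C * (b / T)) := by gcongr
        _ = _ := by ring
    have y2 : 32 * η * (J * (b * M / σ ^ 2)) ≤ 256 * C * η := by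
      calc _ ≤ 32 * η * (8 * C) := by gcongr
        _ = _ := by ring
    gcongr
  rw [hpvi]
  refine (norm_sub_le_norm_sub_add_norm_sub _ _ _).trans (add_le_add c1 ?_)
  have e : ∀ ω, B ω / σ = (∑ j ∈ Finset.range J, blk X b T j ω) / σ := fun ω => rfl
  simp_rw [e]
  refine c2.trans ?_
  unfold pv
  gcongr

lemma stab_int [IsProbabilityMeasure μ] (f : ℕ → Ω → ℝ) (hf : ∀ T, AEStronglyMeasurable (f T) μ)
    (hf0 : ∀ T, ∀ᵐ ω ∂μ, 0 ≤ f T ω)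
    (h : TendstoInMeasure μ f atTop (fun _ => 1)) (ρ : ℝ) (hρ : 0 < ρ) :
    ∀ᶠ T in atTop, ∫ ω, (1 - min (f T ω) 1) ∂μ ≤ ρ := by
  have h1 := h (ENNReal.ofReal (ρ / 2)) (by simpa using by positivity)
  have h2 : ∀ᶠ T in atTop, μ {x | ENNReal.ofReal (ρ / 2) ≤ edist (f T x) 1} <
      ENNReal.ofReal (ρ / 2) := h1.eventually_lt_const (by simpa using by positivity)
  filter_upwards [h2] with T hT
  set A : Set Ω := {x | ENNReal.ofReal (ρ / 2) ≤ edist (f T x) 1} with hA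
  have hAm : NullMeasurableSet A μ :=
    nullMeasurableSet_le aemeasurable_const ((hf T).aemeasurable.edist aemeasurable_const)
  have hi : Integrable (A.indicator fun _ => (1 : ℝ)) μ := (integrable_const 1).indicator₀ hAm
  have h3 : ∫ ω, (1 - min (f T ω) 1) ∂μ ≤ ∫ ω, (ρ / 2 + A.indicator (fun _ => (1 : ℝ)) ω) ∂μ := by
    refine integral_mono_of_nonneg (ae_of_all _ fun ω => ?_) ((integrable_const _).add hi) ?_
    · simp
    · filter_upwards [hf0 T] with ω hω
      have m0 : 0 ≤ min (f T ω) 1 := le_min hω zero_le_one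
      by_cases hωA : ω ∈ A
      · rw [Set.indicator_of_mem hωA]; linarith
      · rw [Set.indicator_of_notMem hωA]
        have : edist (f T ω) 1 < ENNReal.ofReal (ρ / 2) := not_le.1 hωA
        rw [edist_dist, ENNReal.ofReal_lt_ofReal_iff (by positivity), Real.dist_eq, abs_lt] at this
        have : 1 - ρ / 2 ≤ min (f T ω) 1 := le_min (by linarith) (by linarith)
        linarith
  rw [integral_add (integrable_const _) hi, integral_indicator₀ hAm] at h3
  simp at h3
  have h4 : μ.real A ≤ ρ / 2 := by
    rw [Measure.real]
    exact ENNReal.toReal_le_of_le_ofReal (by positivity) hT.le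
  linarith

lemma le_M (f : ℕ → ℝ) (hf : ∀ t, 0 ≤ f t) (s : Finset ℕ) :
    0 ≤ (⨆ t ∈ s, f t) ∧ ∀ t ∈ s, f t ≤ ⨆ t ∈ s, f t := by
  refine ⟨Real.iSup_nonneg fun t => Real.iSup_nonneg fun _ => hf t, fun t ht => ?_⟩
  have hb : BddAbove (Set.range fun t => ⨆ (_ : t ∈ s), f t) := by
    refine ⟨∑ t ∈ s, f t, ?_⟩
    rintro _ ⟨u, rfl⟩
    by_cases hu : u ∈ s
    · simp only [ciSup_pos hu]
      exact Finset.single_le_sum (fun i _ => hf i) hu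
    · simp only [hu, Real.iSup_of_isEmpty]
      exact Finset.sum_nonneg fun i _ => hf i
  refine le_ciSup_of_le hb t ?_
  rw [ciSup_pos ht]

lemma V_eq (ℱ : Filtration ℕ m0) (X : ℕ → Ω → ℝ) (b J T : ℕ) (tI : ℕ → ℕ)
    (ht : ∀ j, tI j = if j = J + 1 then T + 1 else (j - 1) * b + 1)
    (hJ1 : (J - 1) * b < T) (hJ2 : T ≤ J * b) (ω : Ω) :
    ∑ j ∈ Finset.Icc 1 J, (μ[fun ω' => (∑ t ∈ Finset.Icc (tI j + 1) (tI (j + 1) - 1), X t ω') ^ 2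
          | ℱ (tI j - 1)]) ω = pv ℱ X μ b T J ω := by
  have c : Finset.Icc 1 J = Finset.Ico 1 (J + 1) := by ext; simp
  rw [c, Finset.sum_Ico_eq_sum_range, pv]
  refine Finset.sum_congr (by simp) fun j hj => ?_
  have hj' : j < J := by simpa using hj
  have h1 : tI (1 + j) = j * b + 1 := by
    rw [ht, if_neg (by omega)]; simp
  have h2 : tI (1 + j + 1) - 1 = min ((j + 1) * b) T := by
    rw [ht]
    split_ifs with h
    · have : j + 1 = J := by omega
      rw [this, min_eq_right hJ2]; simp
    · have h3 : j + 1 ≤ J - 1 := by omega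
      have h4 := Nat.mul_le_mul_right b h3
      rw [min_eq_left (by omega)]
      simp [add_comm]
  rw [h1, h2]
  simp only [Nat.add_sub_cancel]
  rfl

lemma mean_zero [IsProbabilityMeasure μ] (ℱ : Filtration ℕ m0) (X : ℕ → Ω → ℝ)
    (hlag2 : ∀ t, 2 ≤ t → μ[X t | ℱ (t - 2)] =ᵐ[μ] 0) (t : ℕ) (ht : 2 ≤ t) :
    ∫ ω, X t ω ∂μ = 0 := by
  rw [← integral_condExp (ℱ.le (t - 2)), integral_congr_ae (hlag2 t ht)]
  simp

/-- The partial sums eventually have positive variance. -/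
lemma pos_var [IsProbabilityMeasure μ] (ℱ : Filtration ℕ m0) (X : ℕ → Ω → ℝ)
    (hL2 : ∀ t, 2 ≤ t → MemLp (X t) 2 μ)
    (M q : ℕ → ℝ) (hq : ∀ T, q T = ∫ ω, (∑ t ∈ Finset.Icc 2 T, X t ω) ^ 2 ∂μ)
    (hM : ∀ T t, 2 ≤ t → t ≤ T → ∫ ω, (X t ω) ^ 2 ∂μ ≤ M T)
    (C : ℝ) (hC : ∀ᶠ (T : ℕ) in atTop, (T : ℝ) * M T / q T ≤ C)
    (b J : ℕ → ℕ) (hbinf : Tendsto b atTop atTop)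
    (hbT : ∀ᶠ T in atTop, b T ≤ T)
    (hst : TendstoInMeasure μ (fun T ω => pv ℱ X μ (b T) T (J T) ω /
      ∫ ω, pv ℱ X μ (b T) T (J T) ω ∂μ) atTop (fun _ => 1)) :
    ∀ᶠ T in atTop, 0 < q T := by
  by_contra hcon
  have hfr : ∃ᶠ T in atTop, ¬ 0 < q T := not_eventually.1 hcon
  have hq0 : ∀ T, 0 ≤ q T := fun T => by
    rw [hq]; exact integral_nonneg fun ω => by positivity
  have hSl : ∀ T, MemLp (fun ω => ∑ t ∈ Finset.Icc 2 T, X t ω) 2 μ := fun T =>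
    memLp_finsetSum _ fun t ht => hL2 t (Finset.mem_Icc.1 ht).1
  have hSz : ∀ T, q T = 0 → ∀ᵐ ω ∂μ, ∑ t ∈ Finset.Icc 2 T, X t ω = 0 := by
    intro T h
    rw [hq, integral_eq_zero_iff_of_nonneg (fun ω => by positivity) (hSl T).integrable_sq] at h
    filter_upwards [h] with ω hω
    simpa using hω
  obtain ⟨N, hN⟩ := eventually_atTop.1 hC
  obtain ⟨T0, hT0q, hT0⟩ := (hfr.and_eventually
    (eventually_ge_atTop (max N (max 2 ⌈C⌉₊)))).exists
  have hT0N : N ≤ T0 := le_trans (le_max_left _ _) hT0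
  have hT02 : 2 ≤ T0 := le_trans (le_trans (le_max_left _ _) (le_max_right _ _)) hT0
  have hT0C : C ≤ T0 := Nat.ceil_le.1 (le_trans (le_trans (le_max_right _ _) (le_max_right _ _)) hT0)
  have hall : ∀ T, T0 ≤ T → q T = 0 := by
    intro T hT
    induction T, hT using Nat.le_induction with
    | base => exact le_antisymm (not_lt.1 hT0q) (hq0 _)
    | succ T hT ih =>
      by_contra hne
      have hpos : 0 < q (T + 1) := lt_of_le_of_ne (hq0 _) (Ne.symm hne)
      have e : q (T + 1) = ∫ ω, (X (T + 1) ω) ^ 2 ∂μ := by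
        rw [hq]
        apply integral_congr_ae
        filter_upwards [hSz T ih] with ω hω
        rw [Finset.sum_Icc_succ_top (by omega), hω, zero_add]
      have h1 := hN (T + 1) (by omega)
      rw [div_le_iff₀ hpos] at h1
      have h2 : q (T + 1) ≤ M (T + 1) := by rw [e]; exact hM _ _ (by omega) le_rfl
      have h3 : C < ((T + 1 : ℕ) : ℝ) := by
        have : (T0 : ℝ) ≤ T := by exact_mod_cast hT
        push_cast; linarith
      have h4 : ((T + 1 : ℕ) : ℝ) * q (T + 1) ≤ ((T + 1 : ℕ) : ℝ) * M (T + 1) := by gcongr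
      nlinarith
  have hae : ∀ᵐ ω ∂μ, ∀ T, T0 ≤ T → ∑ t ∈ Finset.Icc 2 T, X t ω = 0 := by
    rw [ae_all_iff]; intro T
    by_cases hT : T0 ≤ T
    · filter_upwards [hSz T (hall T hT)] with ω hω _ using hω
    · exact ae_of_all _ fun ω h => absurd h hT
  have hblk : ∀ T, T0 ≤ b T → b T ≤ T → ∀ j, ∫ ω, blk X (b T) T j ω ^ 2 ∂μ = 0 := by
    intro T h1 h2 j
    have : (fun ω => blk X (b T) T j ω ^ 2) =ᵐ[μ] 0 := by
      filter_upwards [hae] with ω hω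
      have hX : ∀ t, T0 < t → X t ω = 0 := by
        intro t ht
        obtain ⟨u, rfl⟩ : ∃ u, t = u + 1 := ⟨t - 1, by omega⟩
        have e1 := hω (u + 1) (by omega)
        rw [Finset.sum_Icc_succ_top (by omega), hω u (by omega), zero_add] at e1
        exact e1
      have : blk X (b T) T j ω = 0 := by
        rcases Nat.eq_zero_or_pos j with rfl | hj
        · have := hω (min ((0 + 1) * b T) T) (by simp; omega)
          simpa [blk] using this
        · apply Finset.sum_eq_zero
          intro t ht
          have h3 := (Finset.mem_Icc.1 ht).1
          have h4 : b T ≤ j * b T := Nat.le_mul_of_pos_left _ hj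
          exact hX t (by omega)
      simp [this]
    rw [integral_congr_ae this]; simp
  have h1 := hst 1 (by simp)
  have h2 := h1.eventually_lt_const (show (0 : ENNReal) < 1 by simp)
  obtain ⟨T, h3, h4, h5⟩ := (h2.and ((hbinf.eventually_ge_atTop T0).and hbT)).exists
  have h6 : ∫ ω, pv ℱ X μ (b T) T (J T) ω ∂μ = 0 := by
    rw [pv_int]; exact Finset.sum_eq_zero fun j _ => hblk T h4 h5 j
  simp only [h6] at h3
  simp [edist_dist] at h3

lemma pv_nonneg (ℱ : Filtration ℕ m0) (X : ℕ → Ω → ℝ) (b T J : ℕ) :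
    ∀ᵐ ω ∂μ, 0 ≤ pv ℱ X μ b T J ω := by
  have : ∀ j, ∀ᵐ ω ∂μ, 0 ≤ (μ[fun ω' => blk X b T j ω' ^ 2 | ℱ (j * b)]) ω := fun j =>
    condExp_nonneg (ae_of_all _ fun ω => by positivity)
  filter_upwards [ae_all_iff.2 this] with ω hω
  exact Finset.sum_nonneg fun j _ => hω j

lemma pv_integrable (ℱ : Filtration ℕ m0) (X : ℕ → Ω → ℝ) (b T J : ℕ) :
    Integrable (pv ℱ X μ b T J) μ :=
  integrable_finsetSum _ fun j _ => integrable_condExp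

lemma levy [IsProbabilityMeasure μ] (Z : ℕ → Ω → ℝ) (hZ : ∀ T, AEMeasurable (Z T) μ)
    (h : ∀ t : ℝ, Tendsto (fun T => ∫ ω, Complex.exp (Complex.I * ((t * Z T ω : ℝ) : ℂ)) ∂μ) atTop
      (nhds ((Real.exp (-(t ^ 2 / 2)) : ℝ) : ℂ))) (f : BoundedContinuousFunction ℝ ℝ) :
    Tendsto (fun T => ∫ ω, f (Z T ω) ∂μ) atTop (nhds (∫ x, f x ∂(gaussianReal 0 1))) := by
  let P : ℕ → ProbabilityMeasure ℝ := fun T =>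
    ⟨μ.map (Z T), Measure.isProbabilityMeasure_map (hZ T)⟩
  let Q : ProbabilityMeasure ℝ := ⟨gaussianReal 0 1, inferInstance⟩
  have h1 : Tendsto P atTop (nhds Q) := by
    rw [ProbabilityMeasure.tendsto_iff_tendsto_charFun]
    intro t
    have e1 : charFun (Q : Measure ℝ) t = ((Real.exp (-(t ^ 2 / 2)) : ℝ) : ℂ) := by
      change charFun (gaussianReal 0 1) t = _
      rw [charFun_gaussianReal]
      push_cast
      congr 1; simp
    have e2 : ∀ T, charFun (P T : Measure ℝ) t =
        ∫ ω, Complex.exp (Complex.I * ((t * Z T ω : ℝ) : ℂ)) ∂μ := by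
      intro T
      change charFun (μ.map (Z T)) t = _
      rw [charFun_apply_real, integral_map (hZ T)
        (Continuous.aestronglyMeasurable (by fun_prop))]
      congr 1; ext ω; congr 1; push_cast; ring
    rw [e1]; simp_rw [e2]; exact h t
  have h2 := (ProbabilityMeasure.tendsto_iff_forall_integral_tendsto.1 h1) f
  have e3 : ∀ T, ∫ x, f x ∂(P T : Measure ℝ) = ∫ ω, f (Z T ω) ∂μ := fun T =>
    integral_map (hZ T) f.continuous.aestronglyMeasurable
  simp_rw [e3] at h2
  exact h2

lemma small_eps (t δ : ℝ) (hδ : 0 < δ) : ∃ ε : ℝ, 0 < ε ∧ 4 * |t| ^ 3 * ε + t ^ 4 / 4 * ε ^ 2 < δ := by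
  have hc : Continuous fun ε : ℝ => 4 * |t| ^ 3 * ε + t ^ 4 / 4 * ε ^ 2 := by fun_prop
  have h1 : Tendsto (fun ε : ℝ => 4 * |t| ^ 3 * ε + t ^ 4 / 4 * ε ^ 2) (nhdsWithin 0 (Set.Ioi 0))
      (nhds 0) := by
    have := (hc.tendsto 0).mono_left (nhdsWithin_le_nhds (s := Set.Ioi 0))
    simpa using this
  obtain ⟨ε, h2, h3⟩ := ((h1.eventually_lt_const hδ).and self_mem_nhdsWithin).exists
  exact ⟨ε, h3, h2⟩

end SRSB


/-- Central limit theorem for lag-two martingale difference sequences under the blocked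
SRSB design (Theorem 2 of the paper): if `E[X_t | F_{t−2}] = 0`, the standardized squared
increments are uniformly integrable, `T · max_{2≤t≤T} Var(X_t)/S_T² = O(1)`, and the
blockwise predictable variance (with blocks of size `b_T → ∞`, `T/b_T → ∞`) is stable,
then `S_T⁻¹ Σ_{t=2}^T X_t` converges in distribution to `N(0,1)`. -/
theorem srsb_carryover_clt
    {Ω : Type*} {m0 : MeasurableSpace Ω} {μ : Measure Ω} [IsProbabilityMeasure μ]
    (ℱ : Filtration ℕ m0)
    (X : ℕ → Ω → ℝ)
    (hmeas : ∀ t, 2 ≤ t → StronglyMeasurable[ℱ t] (X t))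
    (hL2 : ∀ t, 2 ≤ t → MemLp (X t) 2 μ)
    (hlag2 : ∀ t, 2 ≤ t → μ[X t | ℱ (t - 2)] =ᵐ[μ] 0)
    -- S_T² = Var(Σ_{t=2}^T X_t)
    (Ssq : ℕ → ℝ)
    (hSsq : ∀ T, Ssq T = variance (fun ω => ∑ t ∈ Finset.Icc 2 T, X t ω) μ)
    -- (a) uniform integrability of {X_t²/E[X_t²] : 2 ≤ t}
    (hUI : ∀ ε > (0 : ℝ), ∃ K : ℝ, ∀ t, 2 ≤ t →
      ∫ ω in {ω | K ≤ (X t ω) ^ 2 / (∫ ω', (X t ω') ^ 2 ∂μ)},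
        (X t ω) ^ 2 / (∫ ω', (X t ω') ^ 2 ∂μ) ∂μ ≤ ε)
    -- (b) T · max_{2≤t≤T} Var(X_t) / S_T² = O(1)
    (hbd : ∃ C : ℝ, ∀ᶠ (T : ℕ) in atTop,
      (T : ℝ) * (⨆ t ∈ Finset.Icc 2 T, variance (X t) μ) / Ssq T ≤ C)
    -- (c) block structure: b_T → ∞, T/b_T → ∞,
    -- t_j = (j−1)b_T + 1 for 1 ≤ j ≤ J = ⌈T/b_T⌉, t_{J+1} = T+1
    (b : ℕ → ℕ) (hbpos : ∀ T, 0 < b T)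
    (hbinf : Tendsto b atTop atTop)
    (hTb : Tendsto (fun (T : ℕ) => (T : ℝ) / (b T : ℝ)) atTop atTop)
    (J : ℕ → ℕ) (hJ : ∀ T, J T = ⌈(T : ℝ) / (b T : ℝ)⌉₊)
    (tIdx : ℕ → ℕ → ℕ)
    (htIdx : ∀ T j, tIdx T j = if j = J T + 1 then T + 1 else (j - 1) * b T + 1)
    -- blockwise predictable variance
    (V : ℕ → Ω → ℝ)
    (hV : ∀ T ω, V T ω =
      ∑ j ∈ Finset.Icc 1 (J T),
        (μ[fun ω' =>
            (∑ t ∈ Finset.Icc (tIdx T j + 1) (tIdx T (j + 1) - 1), X t ω') ^ 2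
          | ℱ (tIdx T j - 1)]) ω)
    -- stability: V_J² / E[V_J²] → 1 in probability
    (hstable : TendstoInMeasure μ (fun T ω => V T ω / (∫ ω', V T ω' ∂μ))
      atTop (fun _ => 1)) :
    -- conclusion: S_T⁻¹ Σ_{t=2}^T X_t ⇒ N(0,1)
    ∀ f : BoundedContinuousFunction ℝ ℝ,
      Tendsto
        (fun T => ∫ ω, f ((∑ t ∈ Finset.Icc 2 T, X t ω) / Real.sqrt (Ssq T)) ∂μ)
        atTop (nhds (∫ x, f x ∂(gaussianReal 0 1))) := by
  classical
  have hSl : ∀ T, MemLp (fun ω => ∑ t ∈ Finset.Icc 2 T, X t ω) 2 μ := fun T =>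
    memLp_finsetSum _ fun t ht => hL2 t (Finset.mem_Icc.1 ht).1
  have hvar : ∀ t, 2 ≤ t → variance (X t) μ = ∫ ω, (X t ω) ^ 2 ∂μ := fun t ht =>
    variance_of_integral_eq_zero (hL2 t ht).aestronglyMeasurable.aemeasurable
      (SRSB.mean_zero ℱ X hlag2 t ht)
  have hq : ∀ T, Ssq T = ∫ ω, (∑ t ∈ Finset.Icc 2 T, X t ω) ^ 2 ∂μ := by
    intro T
    rw [hSsq]
    refine variance_of_integral_eq_zero (hSl T).aestronglyMeasurable.aemeasurable ?_
    rw [integral_finsetSum _ fun t ht =>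
      (hL2 t (Finset.mem_Icc.1 ht).1).integrable (by norm_num)]
    exact Finset.sum_eq_zero fun t ht => SRSB.mean_zero ℱ X hlag2 t (Finset.mem_Icc.1 ht).1
  set M : ℕ → ℝ := fun T => ⨆ t ∈ Finset.Icc 2 T, variance (X t) μ with hMdef
  have hM0 : ∀ T, 0 ≤ M T := fun T =>
    (SRSB.le_M (fun t => variance (X t) μ) (fun t => variance_nonneg _ _) (Finset.Icc 2 T)).1
  have hM : ∀ T t, 2 ≤ t → t ≤ T → ∫ ω, (X t ω) ^ 2 ∂μ ≤ M T := by
    intro T t h1 h2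
    rw [← hvar t h1]
    exact (SRSB.le_M (fun t => variance (X t) μ) (fun t => variance_nonneg _ _)
      (Finset.Icc 2 T)).2 t (Finset.mem_Icc.2 ⟨h1, h2⟩)
  obtain ⟨C0, hC0⟩ := hbd
  have hVp : ∀ T, V T = SRSB.pv ℱ X μ (b T) T (J T) := by
    intro T
    ext ω
    rcases Nat.eq_zero_or_pos T with h0 | h0
    · subst h0
      have : J 0 = 0 := by rw [hJ]; simp
      rw [hV, this]; simp [SRSB.pv]
    · have hc := SRSB.ceil_facts (b T) T (hbpos T) h0
      rw [← hJ T] at hc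
      rw [hV]
      exact SRSB.V_eq ℱ X (b T) (J T) T (tIdx T) (htIdx T) hc.2.1 hc.2.2 ω
  simp_rw [hVp] at hstable
  have hbT : ∀ᶠ T in atTop, b T ≤ T := by
    filter_upwards [hTb.eventually_ge_atTop 1] with T hT
    have hb' : (0 : ℝ) < b T := by exact_mod_cast hbpos T
    rw [le_div_iff₀ hb', one_mul] at hT
    exact_mod_cast hT
  have hpos := SRSB.pos_var ℱ X hL2 M Ssq hq hM C0 hC0 b J hbinf hbT hstable
  refine SRSB.levy (fun T ω => (∑ t ∈ Finset.Icc 2 T, X t ω) / Real.sqrt (Ssq T))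
    (fun T => (hSl T).aestronglyMeasurable.aemeasurable.div_const _) ?_
  intro t
  rw [Metric.tendsto_nhds]
  intro δ hδ
  set C : ℝ := max C0 0 with hCdef
  have hC : 0 ≤ C := le_max_right _ _
  set a : ℝ := 4 * t ^ 2 + t ^ 4 / 4 with ha
  have ha0 : 0 ≤ a := by positivity
  obtain ⟨ε, hε, hε2⟩ := SRSB.small_eps t (δ / 5) (by positivity)
  obtain ⟨η, hη, hη2⟩ : ∃ η : ℝ, 0 < η ∧ a * (256 * C * η) < δ / 5 := by
    refine ⟨δ / 5 / (a * (256 * C) + 1), by positivity, ?_⟩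
    have h1 : 0 < a * (256 * C) + 1 := by positivity
    rw [show a * (256 * C * (δ / 5 / (a * (256 * C) + 1))) =
      (a * (256 * C)) * (δ / 5) / (a * (256 * C) + 1) by ring, div_lt_iff₀ h1]
    nlinarith
  obtain ⟨K, hK, hU⟩ := SRSB.ui_conv X hL2 hUI η hη
  have hbR : Tendsto (fun T => (b T : ℝ)) atTop atTop := tendsto_natCast_atTop_atTop.comp hbinf
  have l1 : Tendsto (fun T => C / (b T : ℝ)) atTop (nhds 0) := hbR.const_div_atTop C
  have l2 : Tendsto (fun T => |t| * (2 * √(C / (b T : ℝ)))) atTop (nhds 0) := by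
    have := ((l1.sqrt).const_mul 2).const_mul |t|
    simpa using this
  have l3 : Tendsto (fun T : ℕ => a * (32768 * (K ^ 2 / ε ^ 2) * (32 * C ^ 2 * ((b T : ℝ) / T))))
      atTop (nhds 0) := by
    have h1 : Tendsto (fun T : ℕ => (b T : ℝ) / T) atTop (nhds 0) := by
      have := hTb.inv_tendsto_atTop
      refine this.congr fun T => ?_
      simp
    have := ((h1.const_mul (32 * C ^ 2)).const_mul (32768 * (K ^ 2 / ε ^ 2))).const_mul a
    simpa using this
  have l4 := SRSB.stab_int
    (fun T ω => SRSB.pv ℱ X μ (b T) T (J T) ω / ∫ ω, SRSB.pv ℱ X μ (b T) T (J T) ω ∂μ)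
    (fun T => ((SRSB.pv_integrable ℱ X (b T) T (J T)).div_const _).aestronglyMeasurable)
    (fun T => by
      filter_upwards [SRSB.pv_nonneg (μ := μ) ℱ X (b T) T (J T)] with ω hω
      refine div_nonneg hω (integral_nonneg_of_ae (SRSB.pv_nonneg ℱ X (b T) T (J T))))
    hstable (δ / 5 / (t ^ 2 + 1)) (by positivity)
  filter_upwards [hpos, hC0, hbT, hbinf.eventually_ge_atTop 2, l1.eventually_le_const
    (show (0 : ℝ) < 1 / 4 by norm_num), l2.eventually_lt_const (show (0 : ℝ) < δ / 5 by positivity),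
    l3.eventually_lt_const (show (0 : ℝ) < δ / 5 by positivity), l4, eventually_gt_atTop 0]
    with T g1 g2 g3 g4 g5 g6 g7 g8 g9
  have hc := SRSB.ceil_facts (b T) T (hbpos T) g9
  rw [← hJ T] at hc
  have hsq : √(Ssq T) ^ 2 = Ssq T := Real.sq_sqrt g1.le
  have hCM : (T : ℝ) * M T ≤ C * √(Ssq T) ^ 2 := by
    rw [hsq]
    have h1 : (T : ℝ) * M T / Ssq T ≤ C0 := g2
    rw [div_le_iff₀ g1] at h1
    exact h1.trans (mul_le_mul_of_nonneg_right (le_max_left _ _) g1.le)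
  have main := SRSB.fixedT ℱ X hmeas hL2 hlag2 (hM0 T) hK hη.le hε (Real.sqrt_pos.2 g1)
    (b T) T (J T) g4 g3 hc.1 hc.2.1 hc.2.2 (hM T) hU (by rw [← hq T]) hC hCM g5 t
  rw [dist_eq_norm]
  refine main.trans_lt ?_
  have h8 : t ^ 2 * ∫ ω, (1 - min (SRSB.pv ℱ X μ (b T) T (J T) ω /
      ∫ ω, SRSB.pv ℱ X μ (b T) T (J T) ω ∂μ) 1) ∂μ ≤ δ / 5 := by
    calc _ ≤ t ^ 2 * (δ / 5 / (t ^ 2 + 1)) := mul_le_mul_of_nonneg_left g8 (by positivity)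
      _ ≤ (t ^ 2 + 1) * (δ / 5 / (t ^ 2 + 1)) := by gcongr; linarith
      _ = _ := by field_simp
  rw [← ha, mul_add]
  linarith
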